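/- arXiv:2509.00871 — 2 statements merged into one kernel-verified Lean document; each statement's English description precedes it below -/
import Mathlib

section
/- For any collection {R_i}_{i∈I} of biclosed subsets of Φ⁺, the set Φ⁺ ∩ Span_{≥0}(⋃_{i∈I} R_i) is biclosed, and it is the least upper bound of the collection {R_i}_{i∈I} in the poset of biclosed subsets of Φ⁺ ordered by inclusion. -/
open scoped NNReal

noncomputable section

/-- The ambient vector space `V = ℝ³`. -/
abbrev V : Type := Fin 3 → ℝ

/-- The symmetric bilinear form with `⟨αᵢ,αⱼ⟩ = 1` if `i = j` and `-1` otherwise. -/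
def B (x y : V) : ℝ := 2 * (∑ i, x i * y i) - (∑ i, x i) * (∑ i, y i)

/-- The associated quadratic form. -/
def Q (x : V) : ℝ := B x x

/-- The simple roots `α₁, α₂, α₃` (the standard basis vectors). -/
def α (i : Fin 3) : V := Pi.single i 1

/-- The set of simple roots. -/
def Δ : Set V := Set.range α

/-- `f` is the reflection `r_{αᵢ} : x ↦ x - 2⟨αᵢ,x⟩αᵢ` for some `i` (note `⟨αᵢ,αᵢ⟩ = 1`). -/
def IsSimpleReflection (f : V ≃ₗ[ℝ] V) : Prop :=
  ∃ i : Fin 3, ∀ x : V, f x = x - (2 * B (α i) x) • α i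

/-- The group `W ≤ GL(V)` generated by the three simple reflections:
the standard reflection representation of `U₃`. -/
def W : Subgroup (V ≃ₗ[ℝ] V) := Subgroup.closure {f | IsSimpleReflection f}

/-- The root system `Φ = {w·αᵢ : w ∈ W, i ∈ {1,2,3}}`. -/
def Φ : Set V := {x | ∃ w ∈ W, ∃ i : Fin 3, x = w (α i)}

/-- `Span_{≥0}(X)`: the set of nonnegative linear combinations of elements of `X`. -/
def nnspan (X : Set V) : Set V := (Submodule.span ℝ≥0 X : Set V)

/-- The positive roots `Φ⁺ = Φ ∩ Span_{≥0}(Δ)`. -/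
def Φpos : Set V := Φ ∩ nnspan Δ

/-- `R ⊆ Φ⁺` is closed if for all `a, b ∈ R`, `Span_{≥0}{a,b} ∩ Φ⁺ ⊆ R`. -/
def IsClosedSet (R : Set V) : Prop := ∀ a ∈ R, ∀ b ∈ R, nnspan {a, b} ∩ Φpos ⊆ R

/-- `R` is a biclosed subset of `Φ⁺`. -/
def IsBiclosed (R : Set V) : Prop := R ⊆ Φpos ∧ IsClosedSet R ∧ IsClosedSet (Φpos \ R)

/-- The determinant of two integer vectors in the plane. -/
def cross (x y : ℤ × ℤ) : ℤ := x.1 * y.2 - x.2 * y.1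

/-- The symmetric product of two integer plane vectors, an identification of `V` with the
symmetric square of the plane under which roots are products of unimodular pairs. -/
def symProd (x y : ℤ × ℤ) : V :=
  ![(x.2 * y.2 : ℤ), (x.1 * y.1 : ℤ), ((x.1 - x.2) * (y.1 - y.2) : ℤ)]

lemma symProd_comm (x y : ℤ × ℤ) : symProd x y = symProd y x := by
  simp only [symProd, mul_comm]

lemma symProd_add (x y z : ℤ × ℤ) : symProd x (y + z) = symProd x y + symProd x z := by
  ext i; fin_cases i <;> simp [symProd] <;> ring

lemma symProd_neg (x y : ℤ × ℤ) : symProd x (-y) = -symProd x y := by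
  ext i; fin_cases i <;> simp [symProd]; ring

lemma symProd_smul (n : ℤ) (x y : ℤ × ℤ) : symProd x (n • y) = (n : ℝ) • symProd x y := by
  ext i; fin_cases i <;> simp [symProd] <;> ring

lemma cross_comm (x y : ℤ × ℤ) : cross x y = -cross y x := by
  simp only [cross]; ring

/-- The action of the `i`-th simple reflection on the integer plane. -/
def planeRefl (i : Fin 3) (x : ℤ × ℤ) : ℤ × ℤ :=
  ![(x.1, 2 * x.1 - x.2), (2 * x.2 - x.1, x.2), (x.1, -x.2)] i

lemma planeRefl_planeRefl (i : Fin 3) (x : ℤ × ℤ) : planeRefl i (planeRefl i x) = x := by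
  fin_cases i <;> ext <;> simp [planeRefl]

lemma cross_planeRefl (i : Fin 3) (x y : ℤ × ℤ) :
    cross (planeRefl i x) (planeRefl i y) = -cross x y := by
  fin_cases i <;> simp [planeRefl, cross] <;> ring

lemma symProd_planeRefl (i : Fin 3) (x y : ℤ × ℤ) :
    symProd (planeRefl i x) (planeRefl i y) =
      symProd x y - (2 * B (α i) (symProd x y)) • α i := by
  fin_cases i <;> ext j <;> fin_cases j <;>
    simp [planeRefl, symProd, B, α, Fin.sum_univ_three] <;> ring

lemma B_α (i : Fin 3) (x : V) : B (α i) x = 2 * x i - ∑ j, x j := by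
  simp [B, α, Pi.single_apply]

lemma B_α_self (i : Fin 3) : B (α i) (α i) = 1 := by
  rw [B_α]
  norm_num [α]

lemma exists_simpleReflection (i : Fin 3) :
    ∃ f : V ≃ₗ[ℝ] V, ∀ x, f x = x - (2 * B (α i) x) • α i := by
  let g : Module.Dual ℝ V :=
    { toFun := fun x => 2 * B (α i) x
      map_add' := fun x y => by simp [B_α, Finset.sum_add_distrib]; ring
      map_smul' := fun c x => by simp [B_α, ← Finset.mul_sum]; ring }
  have hg : g (α i) = 2 := by
    simp [g, B_α_self]
  exact ⟨Module.reflection hg, fun x => by rw [Module.reflection_apply]; rfl⟩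

lemma α_eq_symProd (i : Fin 3) : ∃ x y, IsUnit (cross x y) ∧ α i = symProd x y := by
  fin_cases i
  · exact ⟨(0, 1), (1, 1), by simp [cross], by ext j; fin_cases j <;> simp [symProd, α]⟩
  · exact ⟨(1, 0), (1, 1), by simp [cross], by ext j; fin_cases j <;> simp [symProd, α]⟩
  · exact ⟨(1, 0), (0, -1), by simp [cross], by ext j; fin_cases j <;> simp [symProd, α]⟩

lemma eq_symProd_of_mem_Φ {v : V} (hv : v ∈ Φ) :
    ∃ x y, IsUnit (cross x y) ∧ v = symProd x y := by
  let M : Set V := {v | ∃ x y, IsUnit (cross x y) ∧ v = symProd x y}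
  obtain ⟨w, hw, i, rfl⟩ := hv
  suffices h : ∀ v, w v ∈ M ↔ v ∈ M from (h _).2 (α_eq_symProd i)
  clear i
  induction hw using Subgroup.closure_induction with
  | mem f hf =>
    obtain ⟨i, hf⟩ := hf
    have key : ∀ v ∈ M, f v ∈ M := by
      rintro _ ⟨x, y, hxy, rfl⟩
      exact ⟨planeRefl i x, planeRefl i y, by rw [cross_planeRefl]; exact hxy.neg,
        by rw [symProd_planeRefl, hf]⟩
    have hff : ∀ v, f (f v) = v := by
      intro v
      rw [hf v, map_sub, map_smul, hf v, hf (α i)]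
      rw [B_α_self]
      module
    exact fun v => ⟨fun h => by simpa [hff] using key _ h, key v⟩
  | one => exact fun v => Iff.rfl
  | mul f g _ _ hf hg => exact fun v => (hf _).trans (hg v)
  | inv f _ hf =>
    intro v
    rw [← hf, ← LinearEquiv.mul_apply, mul_inv_cancel]
    rfl

/-- The coordinates of a product of a unimodular pair all have the same sign. -/
lemma symProd_sign {x y : ℤ × ℤ} (h : IsUnit (cross x y)) :
    (∀ i, 0 ≤ symProd x y i) ∨ ∀ i, symProd x y i ≤ 0 := by
  obtain ⟨a, b⟩ := x
  obtain ⟨c, d⟩ := y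
  have aux : ∀ m n : ℤ, (m - n = 1 ∨ m - n = -1) → 0 ≤ m * n := by
    rintro m n (h | h)
    · obtain rfl : m = n + 1 := by omega
      rcases lt_or_ge n 0 with h | h <;> nlinarith
    · obtain rfl : n = m + 1 := by omega
      rcases lt_or_ge m 0 with h | h <;> nlinarith
  rw [Int.isUnit_iff] at h
  simp only [cross] at h
  have h1 := aux (a * d) (b * c) h
  have h2 := aux (b * (c - d)) (d * (a - b)) (by
    rcases h with h | h
    · right; linarith
    · left; linarith)
  have h3 := aux (a * (c - d)) (c * (a - b)) (by
    rcases h with h | h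
    · right; linarith
    · left; linarith)
  have key : (0 ≤ b * d ∧ 0 ≤ a * c ∧ 0 ≤ (a - b) * (c - d)) ∨
      (b * d ≤ 0 ∧ a * c ≤ 0 ∧ (a - b) * (c - d) ≤ 0) := by
    have h1' : 0 ≤ (b * d) * (a * c) := by linarith
    have h2' : 0 ≤ (b * d) * ((a - b) * (c - d)) := by linarith
    have h3' : 0 ≤ (a * c) * ((a - b) * (c - d)) := by linarith
    generalize b * d = p at *
    generalize a * c = q at *
    generalize (a - b) * (c - d) = r at *
    by_contra! hc
    rcases lt_trichotomy p 0 with hp | hp | hp <;> rcases lt_trichotomy q 0 with hq | hq | hq <;>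
      rcases lt_trichotomy r 0 with hr | hr | hr <;>
      first
      | (have := hc.1 (by omega) (by omega); have := hc.2 (by omega) (by omega); omega)
      | nlinarith
  rcases key with ⟨k1, k2, k3⟩ | ⟨k1, k2, k3⟩
  · left; intro i; fin_cases i <;> simp only [symProd] <;> simpa using by exact_mod_cast ‹_›
  · right; intro i; fin_cases i <;> simp only [symProd] <;> simpa using by exact_mod_cast ‹_›

lemma symProd_coord_int (x y : ℤ × ℤ) (i : Fin 3) : ∃ n : ℤ, symProd x y i = n := by
  fin_cases i
  · exact ⟨x.2 * y.2, by simp [symProd]⟩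
  · exact ⟨x.1 * y.1, by simp [symProd]⟩
  · exact ⟨(x.1 - x.2) * (y.1 - y.2), by simp [symProd]⟩

lemma symProd_normSq (x y : ℤ × ℤ) :
    ∑ i, symProd x y i * (2 * symProd x y i - ∑ j, symProd x y j) = (cross x y : ℝ) ^ 2 := by
  simp [symProd, cross, Fin.sum_univ_three]
  ring

lemma symProd_normSq_eq_one {x y : ℤ × ℤ} (h : IsUnit (cross x y)) :
    ∑ i, symProd x y i * (2 * symProd x y i - ∑ j, symProd x y j) = 1 := by
  rw [symProd_normSq]
  rcases Int.isUnit_iff.1 h with h | h <;> simp [h]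

lemma symProd_ne_zero {x y : ℤ × ℤ} (h : IsUnit (cross x y)) : symProd x y ≠ 0 := by
  intro h0
  have := symProd_normSq_eq_one h
  simp [h0] at this

/-- A nonnegative product of a unimodular pair is obtained from a simple root by reflections that
each add a positive multiple of a simple root. -/
lemma symProd_induction {C : V → Prop} (simple : ∀ i, C (α i))
    (step : ∀ (i : Fin 3) (x y : ℤ × ℤ) (c : ℝ), IsUnit (cross x y) → (∀ j, 0 ≤ symProd x y j) →
      0 < c → symProd (planeRefl i x) (planeRefl i y) = symProd x y + c • α i →
      C (symProd x y) → C (symProd (planeRefl i x) (planeRefl i y)))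
    {x y : ℤ × ℤ} (h : IsUnit (cross x y)) (h0 : ∀ j, 0 ≤ symProd x y j) : C (symProd x y) := by
  obtain ⟨n, hn⟩ : ∃ n : ℕ, ∑ j, symProd x y j ≤ n := exists_nat_ge _
  induction n generalizing x y with
  | zero =>
    exfalso
    have h1 : ∀ j, symProd x y j = 0 := by
      have := (Finset.sum_eq_zero_iff_of_nonneg (fun j _ => h0 j)).1
        (le_antisymm (by simpa using hn) (Finset.sum_nonneg fun j _ => h0 j))
      simpa using this
    exact symProd_ne_zero h (funext h1)
  | succ n ih =>
    have hQ := symProd_normSq_eq_one h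
    obtain ⟨i, hi⟩ : ∃ i, 0 < symProd x y i * (2 * symProd x y i - ∑ j, symProd x y j) := by
      by_contra! hc
      have := Finset.sum_nonpos (s := Finset.univ) fun i _ => hc i
      linarith
    have hpos : 0 < 2 * symProd x y i - ∑ j, symProd x y j :=
      pos_of_mul_pos_right hi (h0 i)
    have hrefl := symProd_planeRefl i x y
    rw [B_α] at hrefl
    set c := 2 * (2 * symProd x y i - ∑ j, symProd x y j) with hc
    have hcr : IsUnit (cross (planeRefl i x) (planeRefl i y)) := by
      rw [cross_planeRefl]; exact h.neg
    have hback : symProd x y = symProd (planeRefl i x) (planeRefl i y) + c • α i := by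
      rw [hrefl]; abel
    rcases symProd_sign hcr with hs | hs
    · have hstep := step i (planeRefl i x) (planeRefl i y) c hcr hs (by positivity)
      rw [planeRefl_planeRefl, planeRefl_planeRefl] at hstep
      refine hstep hback (ih hcr hs ?_)
      have hc1 : (1 : ℝ) ≤ c := by
        choose m hm using symProd_coord_int x y
        have : c = ((2 * (2 * m i - ∑ j, m j) : ℤ) : ℝ) := by
          rw [hc]; push_cast; simp only [hm]
        have hc0 : 0 < c := by positivity
        rw [this] at hc0 ⊢
        exact_mod_cast hc0
      have hsum : ∑ j, symProd x y j = ∑ j, symProd (planeRefl i x) (planeRefl i y) j + c := by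
        conv_lhs => rw [hback]
        simp [Finset.sum_add_distrib, α, Pi.single_apply]
      push_cast at hn
      linarith
    · have hz : ∀ j, j ≠ i → symProd x y j = 0 := by
        intro j hj
        have := hs j
        rw [hrefl] at this
        simp only [α, Pi.sub_apply, Pi.smul_apply, Pi.single_eq_of_ne hj, smul_zero,
          sub_zero] at this
        exact le_antisymm this (h0 j)
      have hsi : ∑ j, symProd x y j = symProd x y i :=
        Finset.sum_eq_single_of_mem _ (Finset.mem_univ _) fun j _ hj => hz j hj
      have hi1 : symProd x y i = 1 := by
        rw [Finset.sum_eq_single_of_mem i (Finset.mem_univ _)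
          fun j _ hj => by rw [hz j hj, zero_mul], hsi] at hQ
        nlinarith [h0 i]
      have : symProd x y = α i := by
        ext j
        by_cases hj : j = i
        · subst hj; simp [α, hi1]
        · simp [α, hz j hj, Pi.single_eq_of_ne hj]
      rw [this]
      exact simple i

lemma α_mem_Φ (i : Fin 3) : α i ∈ Φ := ⟨1, W.one_mem, i, rfl⟩

lemma reflection_mem_Φ {v : V} (hv : v ∈ Φ) (i : Fin 3) : v - (2 * B (α i) v) • α i ∈ Φ := by
  obtain ⟨w, hw, j, rfl⟩ := hv
  obtain ⟨f, hf⟩ := exists_simpleReflection i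
  exact ⟨f * w, W.mul_mem (Subgroup.subset_closure ⟨i, hf⟩) hw, j, (hf _).symm⟩

lemma neg_mem_Φ {v : V} (hv : v ∈ Φ) : -v ∈ Φ := by
  obtain ⟨w, hw, j, rfl⟩ := hv
  obtain ⟨f, hf⟩ := exists_simpleReflection j
  refine ⟨w * f, W.mul_mem hw (Subgroup.subset_closure ⟨j, hf⟩), j, ?_⟩
  have : f (α j) = -α j := by rw [hf, B_α_self]; module
  rw [LinearEquiv.mul_apply, this, map_neg]

lemma neg_mem_Φ_iff {v : V} : -v ∈ Φ ↔ v ∈ Φ :=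
  ⟨fun h => by simpa using neg_mem_Φ h, neg_mem_Φ⟩

lemma symProd_mem_Φ {x y : ℤ × ℤ} (h : IsUnit (cross x y)) : symProd x y ∈ Φ := by
  have key : ∀ {x y : ℤ × ℤ}, IsUnit (cross x y) → (∀ j, 0 ≤ symProd x y j) →
      symProd x y ∈ Φ := by
    refine symProd_induction α_mem_Φ fun i x y c _ _ _ _ hC => ?_
    rw [symProd_planeRefl]
    exact reflection_mem_Φ hC i
  rcases symProd_sign h with hs | hs
  · exact key h hs
  · rw [← neg_mem_Φ_iff, ← symProd_neg]
    refine key ?_ fun j => ?_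
    · have : cross x (-y) = -cross x y := by simp [cross]; ring
      rw [this]; exact h.neg
    · rw [symProd_neg]; simpa using hs j

lemma mem_nnspan_Δ {v : V} : v ∈ nnspan Δ ↔ ∀ i, 0 ≤ v i := by
  constructor
  · intro h i
    induction h using Submodule.span_induction with
    | mem x hx =>
      obtain ⟨j, rfl⟩ := hx
      by_cases h : i = j
      · subst h; simp [α]
      · simp [α, Pi.single_eq_of_ne h]
    | zero => simp
    | add x y _ _ hx hy => exact add_nonneg hx hy
    | smul c x _ hx => exact mul_nonneg c.2 hx
  · intro h
    have : v = ∑ i, (⟨v i, h i⟩ : ℝ≥0) • α i := by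
      ext j
      simp [α, Finset.sum_apply, Pi.single_apply]
    rw [this]
    exact Submodule.sum_mem _ fun i _ => Submodule.smul_mem _ _ (Submodule.subset_span ⟨i, rfl⟩)

lemma mem_Φpos {v : V} : v ∈ Φpos ↔ v ∈ Φ ∧ ∀ i, 0 ≤ v i := by
  rw [Φpos, Set.mem_inter_iff, mem_nnspan_Δ]

lemma ne_zero_of_mem_Φ {v : V} (hv : v ∈ Φ) : v ≠ 0 := by
  obtain ⟨x, y, h, rfl⟩ := eq_symProd_of_mem_Φ hv
  exact symProd_ne_zero h

lemma mem_Φpos_or_neg_mem {v : V} (hv : v ∈ Φ) : v ∈ Φpos ∨ -v ∈ Φpos := by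
  obtain ⟨x, y, h, rfl⟩ := eq_symProd_of_mem_Φ hv
  rw [mem_Φpos, mem_Φpos, neg_mem_Φ_iff]
  rcases symProd_sign h with hs | hs
  · exact .inl ⟨hv, hs⟩
  · exact .inr ⟨hv, fun i => by simpa using hs i⟩

lemma neg_notMem_Φpos {v : V} (hv : v ∈ Φpos) : -v ∉ Φpos := by
  intro h
  rw [mem_Φpos] at hv h
  refine ne_zero_of_mem_Φ hv.1 (funext fun i => le_antisymm ?_ (hv.2 i))
  simpa using h.2 i

lemma α_mem_Φpos (i : Fin 3) : α i ∈ Φpos :=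
  ⟨α_mem_Φ i, Submodule.subset_span ⟨i, rfl⟩⟩

lemma combo_mem_nnspan {X : Set V} {u v : V} (hu : u ∈ nnspan X) (hv : v ∈ nnspan X) {s t : ℝ}
    (hs : 0 ≤ s) (ht : 0 ≤ t) : s • u + t • v ∈ nnspan X :=
  Submodule.add_mem _ (Submodule.smul_mem _ (⟨s, hs⟩ : ℝ≥0) hu)
    (Submodule.smul_mem _ (⟨t, ht⟩ : ℝ≥0) hv)

lemma subset_nnspan {X : Set V} : X ⊆ nnspan X := Submodule.subset_span

lemma mem_nnspan_pair {a b v : V} :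
    v ∈ nnspan {a, b} ↔ ∃ s t : ℝ, 0 ≤ s ∧ 0 ≤ t ∧ v = s • a + t • b := by
  constructor
  · intro h
    obtain ⟨s, t, h⟩ := Submodule.mem_span_pair.1 h
    exact ⟨s, t, s.2, t.2, h.symm⟩
  · rintro ⟨s, t, hs, ht, rfl⟩
    exact combo_mem_nnspan (subset_nnspan (by simp)) (subset_nnspan (by simp)) hs ht

lemma IsClosedSet.combo_mem {R : Set V} (hR : IsClosedSet R) {u v : V} (hu : u ∈ R) (hv : v ∈ R)
    {s t : ℝ} (hs : 0 ≤ s) (ht : 0 ≤ t) (h : s • u + t • v ∈ Φpos) : s • u + t • v ∈ R :=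
  hR u hu v hv ⟨mem_nnspan_pair.2 ⟨s, t, hs, ht, rfl⟩, h⟩

/-- A closed set of positive roots containing the simple roots is everything. -/
lemma IsClosedSet.Φpos_subset {R : Set V} (hR : IsClosedSet R) (h : ∀ i, α i ∈ R) :
    Φpos ⊆ R := by
  intro v hv
  rw [mem_Φpos] at hv
  obtain ⟨x, y, hxy, rfl⟩ := eq_symProd_of_mem_Φ hv.1
  refine symProd_induction (C := (· ∈ R)) h (fun i x y c hxy h0 hc he hm => ?_) hxy hv.2
  have := hR.combo_mem hm (h i) zero_le_one hc.le
  rw [one_smul, ← he] at this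
  refine this (mem_Φpos.2 ⟨symProd_mem_Φ ?_, fun j => ?_⟩)
  · rw [cross_planeRefl]; exact hxy.neg
  · rw [he]
    refine add_nonneg (h0 j) (mul_nonneg hc.le ?_)
    by_cases hj : j = i
    · subst hj; simp [α]
    · simp [α, Pi.single_eq_of_ne hj]

/-- A set of roots containing exactly one root of each pair `±v` and closed under taking roots in
the cone of two elements. -/
structure IsHalf (Ψ : Set V) : Prop where
  subset : Ψ ⊆ Φ
  mem_or_neg_mem : ∀ v ∈ Φ, v ∈ Ψ ∨ -v ∈ Ψ
  neg_notMem : ∀ v ∈ Ψ, -v ∉ Ψ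
  combo_mem : ∀ u ∈ Ψ, ∀ v ∈ Ψ, ∀ s t : ℝ, 0 ≤ s → 0 ≤ t → s • u + t • v ∈ Φ → s • u + t • v ∈ Ψ

/-- The half system obtained by negating the roots of `R` in the positive system. -/
def twist (R : Set V) : Set V := {v | v ∈ Φpos ∧ v ∉ R ∨ -v ∈ R}

lemma Φpos_combo {u v : V} (hu : u ∈ Φpos) (hv : v ∈ Φpos) {s t : ℝ} (hs : 0 ≤ s) (ht : 0 ≤ t)
    (h : s • u + t • v ∈ Φ) : s • u + t • v ∈ Φpos :=
  ⟨h, combo_mem_nnspan hu.2 hv.2 hs ht⟩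

lemma twist_combo_aux {R : Set V} (hR : IsBiclosed R) {u r : V} (hu : u ∈ Φpos) (huR : u ∉ R)
    (hr : r ∈ R) {s t : ℝ} (hs : 0 ≤ s) (ht : 0 ≤ t) (h : s • u + t • -r ∈ Φ) :
    s • u + t • -r ∈ twist R := by
  obtain ⟨hsub, hcl, hco⟩ := hR
  set w := s • u + t • -r with hw
  rcases mem_Φpos_or_neg_mem h with hp | hn
  · refine .inl ⟨hp, fun hwR => huR ?_⟩
    rcases hs.eq_or_lt with rfl | hs
    · exfalso
      refine ne_zero_of_mem_Φ h (funext fun i => le_antisymm ?_ ((mem_Φpos.1 hp).2 i))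
      have := mul_nonneg ht ((mem_Φpos.1 (hsub hr)).2 i)
      simp [hw, this]
    · have e : u = s⁻¹ • w + (s⁻¹ * t) • r := by
        rw [hw]
        match_scalars <;> field_simp
        ring
      have := hcl.combo_mem hwR hr (s := s⁻¹) (t := s⁻¹ * t) (by positivity) (by positivity)
      rw [← e] at this
      exact this hu
  · refine .inr (by_contra fun hwR => ?_)
    rcases ht.eq_or_lt with rfl | ht
    · refine ne_zero_of_mem_Φ h (funext fun i => le_antisymm ?_ ?_)
      · simpa using (mem_Φpos.1 hn).2 i
      · simpa [hw] using mul_nonneg hs ((mem_Φpos.1 hu).2 i)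
    · have e : r = (t⁻¹ * s) • u + t⁻¹ • -w := by
        rw [hw]
        match_scalars <;> field_simp
        ring
      have := hco.combo_mem ⟨hu, huR⟩ ⟨hn, hwR⟩ (s := t⁻¹ * s) (t := t⁻¹) (by positivity)
        (by positivity)
      rw [← e] at this
      exact (this (hsub hr)).2 hr

lemma IsBiclosed.isHalf_twist {R : Set V} (hR : IsBiclosed R) : IsHalf (twist R) where
  subset := by
    rintro v (⟨h, -⟩ | h)
    · exact h.1
    · exact neg_mem_Φ_iff.1 (hR.1 h).1
  mem_or_neg_mem := by
    have key : ∀ v ∈ Φpos, v ∈ twist R ∨ -v ∈ twist R := by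
      intro v hv
      by_cases h : v ∈ R
      · exact .inr (.inr (by simpa using h))
      · exact .inl (.inl ⟨hv, h⟩)
    intro v hv
    rcases mem_Φpos_or_neg_mem hv with h | h
    · exact key v h
    · have := key _ h
      rw [neg_neg] at this
      exact this.symm
  neg_notMem := by
    rintro v (⟨h1, h2⟩ | h) (⟨h3, h4⟩ | h')
    · exact neg_notMem_Φpos h1 h3
    · exact h2 (by simpa using h')
    · exact h4 h
    · exact neg_notMem_Φpos (hR.1 h) (hR.1 h')
  combo_mem := by
    rintro u (⟨hu, huR⟩ | hu) v (⟨hv, hvR⟩ | hv) s t hs ht h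
    · exact .inl (hR.2.2.combo_mem ⟨hu, huR⟩ ⟨hv, hvR⟩ hs ht (Φpos_combo hu hv hs ht h))
    · rw [← neg_neg v] at h ⊢
      exact twist_combo_aux hR hu huR hv hs ht h
    · rw [← neg_neg u, add_comm] at h ⊢
      exact twist_combo_aux hR hv hvR hu ht hs h
    · have e : -(s • u + t • v) = s • -u + t • -v := by module
      refine .inr ?_
      rw [← neg_mem_Φ_iff, e] at h
      rw [e]
      exact hR.2.1.combo_mem hu hv hs ht (Φpos_combo (hR.1 hu) (hR.1 hv) hs ht h)

lemma IsHalf.neg {Ψ : Set V} (h : IsHalf Ψ) : IsHalf {v | -v ∈ Ψ} where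
  subset := fun v hv => neg_mem_Φ_iff.1 (h.subset hv)
  mem_or_neg_mem := fun v hv => h.mem_or_neg_mem (-v) (neg_mem_Φ hv)
  neg_notMem := fun v hv => h.neg_notMem (-v) hv
  combo_mem := fun u hu v hv s t hs ht hm => by
    have e : -(s • u + t • v) = s • -u + t • -v := by module
    rw [Set.mem_ofPred_eq, e]
    exact h.combo_mem _ hu _ hv s t hs ht (e ▸ neg_mem_Φ hm)

lemma isUnit_cross_of_mem_Φ {x y : ℤ × ℤ} (h : symProd x y ∈ Φ) : IsUnit (cross x y) := by
  obtain ⟨a, b, hab, he⟩ := eq_symProd_of_mem_Φ h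
  have h1 := symProd_normSq_eq_one hab
  rw [← he, symProd_normSq] at h1
  exact IsUnit.of_mul_eq_one (cross x y) (by rw [← sq]; exact_mod_cast h1)

lemma symProd_neg_neg (x y : ℤ × ℤ) : symProd (-x) (-y) = symProd x y := by
  rw [symProd_neg, symProd_comm, symProd_neg, neg_neg, symProd_comm]

lemma cross_neg (x y : ℤ × ℤ) : cross x (-y) = -cross x y := by
  simp [cross]; ring

lemma cross_combo (p q : ℤ × ℤ) (i j k l : ℤ) :
    cross (i • p + j • q) (k • p + l • q) = (i * l - j * k) * cross p q := by
  simp [cross]; ring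

lemma isUnit_mul_self {e : ℤ} (h : IsUnit e) : e * e = 1 := Int.isUnit_mul_self h

lemma exists_coords {p q : ℤ × ℤ} (h : IsUnit (cross p q)) (x : ℤ × ℤ) :
    ∃ i j : ℤ, x = i • p + j • q := by
  have h1 := isUnit_mul_self h
  refine ⟨cross p q * cross x q, cross p q * cross p x, ?_⟩
  ext
  · simp only [cross, Prod.fst_add, Prod.smul_fst, smul_eq_mul] at h1 ⊢
    linear_combination (-x.1) * h1
  · simp only [cross, Prod.snd_add, Prod.smul_snd, smul_eq_mul] at h1 ⊢
    linear_combination (-x.2) * h1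

lemma eq_add_smul_of_isUnit {r p y : ℤ × ℤ} (hp : IsUnit (cross r p)) (hy : IsUnit (cross r y)) :
    ∃ j : ℤ, y = p + j • r ∨ y = -p + j • r := by
  obtain ⟨j, i, rfl⟩ := exists_coords hp y
  have : cross r (j • r + i • p) = i * cross r p := by simp [cross]; ring
  rw [this, IsUnit.mul_iff, Int.isUnit_iff] at hy
  refine ⟨j, ?_⟩
  rcases hy.1 with rfl | rfl
  · left; module
  · right; module

/-- A plane vector `x` is of negative type if, among the roots `symProd x y`, those
in `Ψ` have `y` directed towards `-x`. -/
def NegType (Ψ : Set V) (x : ℤ × ℤ) : Prop :=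
  ∃ (y : ℤ × ℤ) (k : ℤ), 0 < k ∧ symProd x y ∈ Ψ ∧ symProd x (-(k • x) - y) ∈ Ψ

lemma negType_neg {Ψ : Set V} {x : ℤ × ℤ} (h : NegType Ψ x) : NegType Ψ (-x) := by
  obtain ⟨y, k, hk, h1, h2⟩ := h
  refine ⟨-y, k, hk, by rwa [symProd_neg_neg], ?_⟩
  rwa [← symProd_neg_neg x, show -(-(k • x) - y) = -(k • -x) - -y by module] at h2

lemma negType_neg_iff {Ψ : Set V} {x : ℤ × ℤ} : NegType Ψ (-x) ↔ NegType Ψ x :=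
  ⟨fun h => by simpa using negType_neg h, negType_neg⟩

namespace IsHalf

variable {Ψ : Set V}

lemma isUnit (h : IsHalf Ψ) {x y : ℤ × ℤ} (hS : symProd x y ∈ Ψ) : IsUnit (cross x y) :=
  isUnit_cross_of_mem_Φ (h.subset hS)

lemma notMem_iff (h : IsHalf Ψ) {x y : ℤ × ℤ} (hu : IsUnit (cross x y)) :
    symProd x y ∉ Ψ ↔ symProd x (-y) ∈ Ψ := by
  rw [symProd_neg]
  exact ⟨fun hn => (h.mem_or_neg_mem _ (symProd_mem_Φ hu)).resolve_left hn,
    fun hn hp => h.neg_notMem _ hp hn⟩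

lemma mem_or (h : IsHalf Ψ) {x y : ℤ × ℤ} (hu : IsUnit (cross x y)) :
    symProd x y ∈ Ψ ∨ symProd x (-y) ∈ Ψ := by
  rw [← h.notMem_iff hu]; exact em _

lemma absurd (h : IsHalf Ψ) {x y : ℤ × ℤ} (h1 : symProd x y ∈ Ψ) (h2 : symProd x (-y) ∈ Ψ) :
    False :=
  h.neg_notMem _ h1 (by rwa [← symProd_neg])

lemma fan (h : IsHalf Ψ) {x y y' z : ℤ × ℤ} (hy : symProd x y ∈ Ψ) (hy' : symProd x y' ∈ Ψ)
    {s t n : ℤ} (hs : 0 ≤ s) (ht : 0 ≤ t) (hn : 0 < n) (he : s • y + t • y' = n • z)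
    (hu : IsUnit (cross x z)) : symProd x z ∈ Ψ := by
  have hn' : (0 : ℝ) < n := by exact_mod_cast hn
  have e : symProd x z = ((s : ℝ) / n) • symProd x y + ((t : ℝ) / n) • symProd x y' := by
    have h1 : (n : ℝ) • symProd x z = (s : ℝ) • symProd x y + (t : ℝ) • symProd x y' := by
      rw [← symProd_smul, ← symProd_smul, ← symProd_smul, ← he, symProd_add]
    have h2 : symProd x z = (n : ℝ)⁻¹ • ((n : ℝ) • symProd x z) := by
      rw [smul_smul, inv_mul_cancel₀ hn'.ne', one_smul]
    rw [h2, h1, smul_add, smul_smul, smul_smul]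
    congr 2 <;> ring
  have := h.combo_mem _ hy _ hy' (s / n) (t / n) (div_nonneg (by exact_mod_cast hs) hn'.le)
    (div_nonneg (by exact_mod_cast ht) hn'.le)
  rw [← e] at this
  exact this (symProd_mem_Φ hu)

lemma reflect (h : IsHalf Ψ) {p q : ℤ × ℤ} {i j k l : ℤ} (hpq : symProd p q ∈ Ψ)
    (hxy : symProd (i • p + j • q) (k • p + l • q) ∈ Ψ) (hle : i * l + j * k ≤ 0) :
    symProd (i • p - j • q) (k • p - l • q) ∈ Ψ := by
  have e : symProd (i • p - j • q) (k • p - l • q) =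
      (1 : ℝ) • symProd (i • p + j • q) (k • p + l • q) +
        (-(2 * (i * l + j * k) : ℤ) : ℝ) • symProd p q := by
    ext m; fin_cases m <;> simp [symProd] <;> ring
  rw [e]
  refine h.combo_mem _ hxy _ hpq _ _ zero_le_one ?_ ?_
  · have : ((i * l + j * k : ℤ) : ℝ) ≤ 0 := by exact_mod_cast hle
    push_cast at this ⊢
    linarith
  · rw [← e]
    refine symProd_mem_Φ ?_
    have h1 := h.isUnit hxy
    rw [cross_combo] at h1
    have h2 : cross (i • p - j • q) (k • p - l • q) = -((i * l - j * k) * cross p q) := by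
      simp [cross]; ring
    rw [h2]
    exact h1.neg

lemma not_negType (h : IsHalf Ψ) {r p : ℤ × ℤ} (h1 : symProd r p ∈ Ψ)
    (h2 : symProd r (r - p) ∈ Ψ) : ¬ NegType Ψ r := by
  rintro ⟨y, k, hk, h3, h4⟩
  have hup := h.isUnit h1
  have hun : IsUnit (cross r (-p)) := by rw [cross_neg]; exact hup.neg
  have hur : IsUnit (cross r (p - r)) := by
    have : cross r (p - r) = cross r p := by simp [cross]; ring
    rwa [this]
  have c1 : symProd r (-p) ∉ Ψ := fun hc => h.absurd h1 hc
  have c2 : symProd r (p - r) ∉ Ψ := fun hc => h.absurd hc (by rwa [neg_sub])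
  obtain ⟨j, rfl | rfl⟩ := eq_add_smul_of_isUnit hup (h.isUnit h3)
  · rcases le_or_gt 0 (k + j) with hkj | hkj
    · exact c1 (h.fan h4 h2 (s := 1) (t := k + j) (n := 1 + (k + j)) zero_le_one hkj (by linarith)
        (by module) hun)
    · exact c2 (h.fan h3 h1 (s := 1) (t := -j - 1) (n := -j) zero_le_one (by linarith)
        (by linarith) (by module) hur)
  · rcases le_or_gt j 0 with hj | hj
    · exact c1 (h.fan h3 h2 (s := 1) (t := -j) (n := 1 - j) zero_le_one (by linarith) (by linarith)
        (by module) hun)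
    · exact c2 (h.fan h4 h1 (s := 1) (t := k + j - 1) (n := k + j) zero_le_one (by linarith)
        (by linarith) (by module) hur)

lemma climb (h : IsHalf Ψ) {p q : ℤ × ℤ} (hp : ¬ NegType Ψ p) (hq : ¬ NegType Ψ q)
    (hpq : symProd p q ∈ Ψ) :
    symProd p (p + q) ∈ Ψ ∧ symProd (p + q) q ∈ Ψ ∧ ¬ NegType Ψ (p + q) := by
  have key : ∀ {p q : ℤ × ℤ}, ¬ NegType Ψ p → symProd p q ∈ Ψ → symProd p (p + q) ∈ Ψ := by
    intro p q hp hpq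
    by_contra hc
    have hu : IsUnit (cross p (p + q)) := by
      have : cross p (p + q) = cross p q := by simp [cross]; ring
      rw [this]; exact h.isUnit hpq
    rw [h.notMem_iff hu] at hc
    exact hp ⟨q, 1, one_pos, hpq, by rwa [show -((1 : ℤ) • p) - q = -(p + q) by module]⟩
  have h1 := key hp hpq
  have h2 := key hq (p := q) (q := p) (by rwa [symProd_comm])
  rw [symProd_comm, add_comm] at h2
  exact ⟨h1, h2, h.not_negType (p := p) (by rwa [symProd_comm]) (by rwa [add_sub_cancel_left])⟩

lemma climb_all (h : IsHalf Ψ) {p q : ℤ × ℤ} (hp : ¬ NegType Ψ p) (hq : ¬ NegType Ψ q)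
    (hpq : symProd p q ∈ Ψ) {i j : ℤ} (hi : 0 ≤ i) (hj : 0 ≤ j) (hij : IsCoprime i j) :
    ¬ NegType Ψ (i • p + j • q) := by
  obtain ⟨n, hn⟩ : ∃ n : ℕ, i + j ≤ n := ⟨(i + j).toNat, by omega⟩
  induction n generalizing p q i j with
  | zero =>
    obtain rfl : i = 0 := by omega
    obtain rfl : j = 0 := by omega
    exact (not_isCoprime_zero_zero hij).elim
  | succ n ih =>
    obtain ⟨h1, h2, h3⟩ := h.climb hp hq hpq
    rcases hi.eq_or_lt with rfl | hi'
    · obtain rfl : j = 1 := by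
        rw [isCoprime_zero_left, Int.isUnit_iff] at hij; omega
      simpa using hq
    rcases hj.eq_or_lt with rfl | hj'
    · obtain rfl : i = 1 := by
        rw [isCoprime_zero_right, Int.isUnit_iff] at hij; omega
      simpa using hp
    rcases le_total j i with hle | hle
    · have := ih hp h3 h1 (i := i - j) (j := j) (by omega) hj
        (by simpa [sub_eq_add_neg] using IsCoprime.add_mul_right_left hij (-1))
          (by push_cast at hn; omega)
      rwa [show i • p + j • q = (i - j) • p + j • (p + q) by module]
    · have := ih h3 hq h2 (i := i) (j := j - i) hi (by omega)
        (by simpa [sub_eq_add_neg] using IsCoprime.add_mul_right_right hij (-1))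
          (by push_cast at hn; omega)
      rwa [show i • p + j • q = i • (p + q) + (j - i) • q by module]

lemma climb_neg (h : IsHalf Ψ) {p q : ℤ × ℤ} (hp : NegType Ψ p) (hq : NegType Ψ q)
    (hpq : symProd p (-q) ∈ Ψ) :
    symProd p (-(p + q)) ∈ Ψ ∧ symProd (p + q) (-q) ∈ Ψ ∧ NegType Ψ (p + q) := by
  have key : ∀ {p q : ℤ × ℤ}, NegType Ψ p → symProd p (-q) ∈ Ψ → symProd p (-(p + q)) ∈ Ψ := by
    intro p q hp hpq
    have hu : IsUnit (cross p (p + q)) := by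
      have : cross p (p + q) = -cross p (-q) := by simp [cross]; ring
      rw [this]; exact (h.isUnit hpq).neg
    rw [← h.notMem_iff hu]
    exact fun hc => h.not_negType hc (by rwa [sub_add_cancel_left]) hp
  have h1 := key hp hpq
  have h2 := key hq (p := q) (q := p)
    (by rwa [symProd_neg, symProd_comm, ← symProd_neg])
  have h3 : symProd (p + q) (-q) ∈ Ψ := by
    rwa [symProd_neg, symProd_comm, ← symProd_neg, add_comm p q]
  refine ⟨h1, h3, -p, 1, one_pos, ?_, ?_⟩
  · rwa [symProd_neg, symProd_comm, ← symProd_neg]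
  · rwa [show -((1 : ℤ) • (p + q)) - -p = -q by module]

lemma climb_neg_all (h : IsHalf Ψ) {p q : ℤ × ℤ} (hp : NegType Ψ p) (hq : NegType Ψ q)
    (hpq : symProd p (-q) ∈ Ψ) {i j : ℤ} (hi : 0 ≤ i) (hj : 0 ≤ j) (hij : IsCoprime i j) :
    NegType Ψ (i • p + j • q) := by
  obtain ⟨n, hn⟩ : ∃ n : ℕ, i + j ≤ n := ⟨(i + j).toNat, by omega⟩
  induction n generalizing p q i j with
  | zero =>
    obtain rfl : i = 0 := by omega
    obtain rfl : j = 0 := by omega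
    exact (not_isCoprime_zero_zero hij).elim
  | succ n ih =>
    obtain ⟨h1, h2, h3⟩ := h.climb_neg hp hq hpq
    rcases hi.eq_or_lt with rfl | hi'
    · obtain rfl : j = 1 := by
        rw [isCoprime_zero_left, Int.isUnit_iff] at hij; omega
      simpa using hq
    rcases hj.eq_or_lt with rfl | hj'
    · obtain rfl : i = 1 := by
        rw [isCoprime_zero_right, Int.isUnit_iff] at hij; omega
      simpa using hp
    rcases le_total j i with hle | hle
    · have := ih hp h3 h1 (i := i - j) (j := j) (by omega) hj
        (by simpa [sub_eq_add_neg] using IsCoprime.add_mul_right_left hij (-1))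
          (by push_cast at hn; omega)
      rwa [show i • p + j • q = (i - j) • p + j • (p + q) by module]
    · have := ih h3 hq h2 (i := i) (j := j - i) hi (by omega)
        (by simpa [sub_eq_add_neg] using IsCoprime.add_mul_right_right hij (-1))
          (by push_cast at hn; omega)
      rwa [show i • p + j • q = i • (p + q) + (j - i) • q by module]

lemma climb_edge (h : IsHalf Ψ) {p q : ℤ × ℤ} (hp : ¬ NegType Ψ p) (hq : ¬ NegType Ψ q)
    (hpq : symProd p q ∈ Ψ) {i j k l : ℤ} (hi : 0 ≤ i) (hj : 0 ≤ j) (hk : 0 ≤ k) (hl : 0 ≤ l)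
    (hu : IsUnit (i * l - j * k)) : symProd (i • p + j • q) (k • p + l • q) ∈ Ψ := by
  obtain ⟨n, hn⟩ : ∃ n : ℕ, i + j + k + l ≤ n := ⟨(i + j + k + l).toNat, by omega⟩
  induction n generalizing i j k l with
  | zero =>
    obtain rfl : i = 0 := by omega
    obtain rfl : j = 0 := by omega
    simp at hu
  | succ n ih =>
    push_cast at hn
    have c1 : ∀ {i j k l : ℤ}, IsUnit (i * l - j * k) → IsCoprime i j := by
      intro i j k l hu
      have := isUnit_mul_self hu
      exact ⟨l * (i * l - j * k), -k * (i * l - j * k), by linear_combination this⟩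
    have c2 : ∀ {i j k l : ℤ}, IsUnit (i * l - j * k) → IsCoprime k l := by
      intro i j k l hu
      exact c1 (k := i) (l := j) (by rw [← IsUnit.neg_iff]; convert hu using 1; ring)
    have hij := c1 hu
    have hkl := c2 hu
    by_cases hA : k ≤ i ∧ l ≤ j
    · have hu' : IsUnit ((i - k) * l - (j - l) * k) := by convert hu using 1; ring
      have hkl0 : 0 < k + l := by
        by_contra hc
        obtain rfl : k = 0 := by omega
        obtain rfl : l = 0 := by omega
        simp at hu
      have := (h.climb (h.climb_all hp hq hpq (sub_nonneg.2 hA.1) (sub_nonneg.2 hA.2) (c1 hu'))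
        (h.climb_all hp hq hpq hk hl hkl)
        (ih (sub_nonneg.2 hA.1) (sub_nonneg.2 hA.2) hk hl hu' (by omega))).2.1
      rwa [show (i - k) • p + (j - l) • q + (k • p + l • q) = i • p + j • q by module] at this
    by_cases hB : i ≤ k ∧ j ≤ l
    · have hu' : IsUnit (i * (l - j) - j * (k - i)) := by convert hu using 1; ring
      have hij0 : 0 < i + j := by
        by_contra hc
        obtain rfl : i = 0 := by omega
        obtain rfl : j = 0 := by omega
        simp at hu
      have := (h.climb (h.climb_all hp hq hpq hi hj hij)
        (h.climb_all hp hq hpq (sub_nonneg.2 hB.1) (sub_nonneg.2 hB.2) (c2 hu'))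
        (ih hi hj (sub_nonneg.2 hB.1) (sub_nonneg.2 hB.2) hu' (by omega))).1
      rwa [show i • p + j • q + ((k - i) • p + (l - j) • q) = k • p + l • q by module] at this
    rw [Int.isUnit_iff] at hu
    rcases lt_or_ge k i with hki | hki
    · have hjl : j < l := by by_contra; exact hA ⟨hki.le, by omega⟩
      have h1 : (k + 1) * (j + 1) ≤ i * l :=
        mul_le_mul hki hjl (by omega) (by omega)
      have h2 : k + j ≤ 0 := by rcases hu with h | h <;> linarith
      obtain rfl : k = 0 := by omega
      obtain rfl : j = 0 := by omega
      have h3 : i * l = 1 := by simp at hu; rcases hu with h | h <;> nlinarith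
      rcases Int.mul_eq_one_iff_eq_one_or_neg_one.1 h3 with ⟨rfl, rfl⟩ | ⟨rfl, rfl⟩
      · simpa using hpq
      · omega
    · have hlj : l < j := by by_contra; exact hB ⟨hki, by omega⟩
      have hik : i < k := by by_contra; exact hA ⟨by omega, by omega⟩
      have h1 : (l + 1) * (i + 1) ≤ j * k :=
        mul_le_mul hlj hik (by omega) (by omega)
      have h2 : l + i ≤ 0 := by rcases hu with h | h <;> linarith
      obtain rfl : l = 0 := by omega
      obtain rfl : i = 0 := by omega
      have h3 : j * k = 1 := by simp at hu; rcases hu with h | h <;> nlinarith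
      rcases Int.mul_eq_one_iff_eq_one_or_neg_one.1 h3 with ⟨rfl, rfl⟩ | ⟨rfl, rfl⟩
      · rw [symProd_comm]; simpa using hpq
      · omega

lemma negType_reflect (h : IsHalf Ψ) {p q : ℤ × ℤ} (hpq : symProd p q ∈ Ψ) {i j : ℤ}
    (hi : 0 < i) (hj : 0 < j) (hx : NegType Ψ (i • p + j • q)) : NegType Ψ (i • p - j • q) := by
  obtain ⟨y, k, hk, h1, h2⟩ := hx
  obtain ⟨a, b, rfl⟩ := exists_coords (h.isUnit hpq) y
  set x := i • p + j • q with hx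
  set m : ℤ := |a| + |b| with hm
  have hm0 : 0 ≤ m := by positivity
  have u1 := h.isUnit h1
  have h3 : symProd x (a • p + b • q - (m * k) • x) ∈ Ψ := by
    refine h.fan h1 h2 (s := 1 + m) (t := m) (n := 1) (by omega) hm0 one_pos (by module) ?_
    have : cross x (a • p + b • q - (m * k) • x) = cross x (a • p + b • q) := by
      simp [cross]; ring
    rwa [this]
  have h4 : symProd x (-(k • x) - (a • p + b • q) - (m * k) • x) ∈ Ψ := by
    refine h.fan h1 h2 (s := m) (t := 1 + m) (n := 1) hm0 (by omega) one_pos (by module) ?_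
    have : cross x (-(k • x) - (a • p + b • q) - (m * k) • x) = -cross x (a • p + b • q) := by
      simp [cross]; ring
    rw [this]; exact u1.neg
  have e3 : a • p + b • q - (m * k) • x = (a - m * k * i) • p + (b - m * k * j) • q := by
    rw [hx]; module
  have e4 : -(k • x) - (a • p + b • q) - (m * k) • x =
      (-(k * i) - a - m * k * i) • p + (-(k * j) - b - m * k * j) • q := by
    rw [hx]; module
  rw [e3, hx] at h3
  rw [e4, hx] at h4
  have bound : ∀ z c : ℤ, 0 < z → |c| ≤ m → |c| ≤ m * k * z := by
    intro z c hz hc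
    have hkz : 1 ≤ k * z := Int.mul_pos hk hz
    nlinarith
  have ba : |a| ≤ m := by have := abs_nonneg b; omega
  have bb : |b| ≤ m := by have := abs_nonneg a; omega
  have a1 := abs_le.1 (bound i a hi ba)
  have b1 := abs_le.1 (bound j b hj bb)
  have hki : 0 < k * i := Int.mul_pos hk hi
  have hkj : 0 < k * j := Int.mul_pos hk hj
  have h5 := h.reflect hpq h3 (add_nonpos
    (mul_nonpos_of_nonneg_of_nonpos hi.le (by linarith [b1.2]))
    (mul_nonpos_of_nonneg_of_nonpos hj.le (by linarith [a1.2])))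
  have h6 := h.reflect hpq h4 (add_nonpos
    (mul_nonpos_of_nonneg_of_nonpos hi.le (by linarith [b1.1]))
    (mul_nonpos_of_nonneg_of_nonpos hj.le (by linarith [a1.1])))
  refine ⟨_, k + 2 * m * k, by positivity, h5, ?_⟩
  convert h6 using 2
  module

end IsHalf

/-- A family of integers indexed by a set has constant weak sign. -/
def ConstSign {X : Type*} (N : X → Prop) (f : X → ℤ) : Prop :=
  (∀ x, N x → 0 ≤ f x) ∨ ∀ x, N x → f x ≤ 0

lemma ConstSign.of_mul {X : Type*} {N : X → Prop} {f g c k : X → ℤ} (hf : ConstSign N f)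
    (hg : ConstSign N g) (hc : ∀ x, N x → c x ≠ 0) (he : ∀ x, f x * g x = c x ^ 2 * k x) :
    ConstSign N k := by
  have pos : ∀ x, N x → 0 < c x ^ 2 := fun x hx => by have := hc x hx; positivity
  rcases hf with hf | hf <;> rcases hg with hg | hg
  · exact .inl fun x hx => nonneg_of_mul_nonneg_right
      (he x ▸ mul_nonneg (hf x hx) (hg x hx)) (pos x hx)
  · exact .inr fun x hx => nonpos_of_mul_nonpos_right
      (he x ▸ mul_nonpos_of_nonneg_of_nonpos (hf x hx) (hg x hx)) (pos x hx)
  · exact .inr fun x hx => nonpos_of_mul_nonpos_right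
      (he x ▸ mul_nonpos_of_nonpos_of_nonneg (hf x hx) (hg x hx)) (pos x hx)
  · exact .inl fun x hx => nonneg_of_mul_nonneg_right
      (he x ▸ mul_nonneg_of_nonpos_of_nonpos (hf x hx) (hg x hx)) (pos x hx)

lemma ConstSign.neg {X : Type*} {N : X → Prop} {f : X → ℤ} (hf : ConstSign N f) :
    ConstSign N fun x => -f x := by
  rcases hf with hf | hf
  · exact .inr fun x hx => neg_nonpos.2 (hf x hx)
  · exact .inl fun x hx => neg_nonneg.2 (hf x hx)

lemma isCoprime_of_isUnit_cross {p q y : ℤ × ℤ} {i j : ℤ} (h : IsUnit (cross (i • p + j • q) y)) :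
    IsCoprime i j := by
  have e : cross (i • p + j • q) y = i * cross p y + j * cross q y := by simp [cross]; ring
  rw [e] at h
  have := isUnit_mul_self h
  exact ⟨cross p y * (i * cross p y + j * cross q y), cross q y * (i * cross p y + j * cross q y),
    by linear_combination this⟩

lemma exists_cross_eq_one {x y : ℤ × ℤ} (h : IsUnit (cross x y)) : ∃ z, cross x z = 1 := by
  refine ⟨cross x y • y, ?_⟩
  have : cross x (cross x y • y) = cross x y * cross x y := by simp [cross]; ring
  rw [this, isUnit_mul_self h]

namespace IsHalf

variable {Ψ : Set V}

lemma isCoprime_coords (h : IsHalf Ψ) {p q : ℤ × ℤ} {i j : ℤ} (hx : NegType Ψ (i • p + j • q)) :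
    IsCoprime i j := by
  obtain ⟨y, k, hk, h1, -⟩ := hx
  exact isCoprime_of_isUnit_cross (h.isUnit h1)

lemma mul_nonpos_of_negType (h : IsHalf Ψ) {p q : ℤ × ℤ} (hp : ¬ NegType Ψ p)
    (hq : ¬ NegType Ψ q) (hpq : symProd p q ∈ Ψ) {i j : ℤ} (hx : NegType Ψ (i • p + j • q)) :
    i * j ≤ 0 := by
  have hc := h.isCoprime_coords hx
  by_contra! hij
  rcases pos_and_pos_or_neg_and_neg_of_mul_pos hij with ⟨hi, hj⟩ | ⟨hi, hj⟩
  · exact h.climb_all hp hq hpq hi.le hj.le hc hx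
  · refine h.climb_all hp hq hpq (neg_nonneg.2 hi.le) (neg_nonneg.2 hj.le) hc.neg_neg ?_
    rw [show -i • p + -j • q = -(i • p + j • q) by module]
    exact negType_neg hx

lemma eq_coords {p q : ℤ × ℤ} (h : cross p q = 1) (x : ℤ × ℤ) :
    x = cross x q • p + cross p x • q := by
  ext
  · simp only [cross, Prod.fst_add, Prod.smul_fst, smul_eq_mul] at h ⊢
    linear_combination (-x.1) * h
  · simp only [cross, Prod.snd_add, Prod.smul_snd, smul_eq_mul] at h ⊢
    linear_combination (-x.2) * h

lemma constSign_of_cross_eq_one (h : IsHalf Ψ) {u w : ℤ × ℤ} (hc : cross u w = 1)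
    (hu : ¬ NegType Ψ u) (hw : ¬ NegType Ψ w) :
    ConstSign (NegType Ψ) fun x => cross u x * cross x w := by
  rcases h.mem_or (x := u) (y := w) (by simp [hc]) with hS | hS
  · refine .inr fun x hx => ?_
    rw [eq_coords hc x] at hx
    exact (mul_comm _ _).trans_le (h.mul_nonpos_of_negType hu hw hS hx)
  · refine .inl fun x hx => ?_
    rw [eq_coords hc x, show cross x w • u + cross u x • w =
      cross x w • u + (-cross u x) • (-w) by module] at hx
    have := h.mul_nonpos_of_negType hu (by rwa [negType_neg_iff]) hS hx
    linarith

/-- The vectors of negative type do not interlace with two vectors not of negative type. -/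
lemma constSign (h : IsHalf Ψ) {u v : ℤ × ℤ} (hu1 : ∃ w, cross u w = 1) (hv1 : ∃ w, cross v w = 1)
    (hu : ¬ NegType Ψ u) (hv : ¬ NegType Ψ v) :
    ConstSign (NegType Ψ) fun x => cross u x * cross x v := by
  suffices key : ∀ (n : ℕ) (u v : ℤ × ℤ), 0 ≤ cross u v → cross u v ≤ n →
      (∃ w, cross u w = 1) → (∃ w, cross v w = 1) → ¬ NegType Ψ u → ¬ NegType Ψ v →
      ConstSign (NegType Ψ) fun x => cross u x * cross x v by
    rcases le_total 0 (cross u v) with hd | hd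
    · exact key (cross u v).toNat u v hd (by omega) hu1 hv1 hu hv
    · have := key (-cross u v).toNat u (-v) (by rw [cross_neg]; omega) (by rw [cross_neg]; omega)
        hu1 ?_ hu (by rwa [negType_neg_iff])
      · simpa [cross_neg] using this.neg
      · obtain ⟨w, hw⟩ := hv1
        exact ⟨-w, by simpa [cross] using hw⟩
  clear! u v
  intro n
  induction n with
  | zero =>
    intro u v h0 hd hu1 _ hu hv
    have hd : cross u v = 0 := by push_cast at hd; omega
    obtain ⟨w, hw⟩ := hu1
    obtain hv' := eq_coords hw v
    rw [hd, zero_smul, add_zero] at hv'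
    set k := cross v w
    have e : ∀ x, cross u x * cross x v = -k * cross u x ^ 2 := by
      intro x; rw [hv']; simp [cross]; ring
    simp only [e]
    rcases le_total k 0 with hk | hk
    · exact .inl fun x _ => mul_nonneg (by omega) (sq_nonneg _)
    · exact .inr fun x _ => mul_nonpos_of_nonpos_of_nonneg (by omega) (sq_nonneg _)
  | succ n ih =>
    intro u v h0 hd hu1 hv1 hu hv
    rcases hd.lt_or_eq with hd | hd
    · exact ih u v h0 (by push_cast at hd; omega) hu1 hv1 hu hv
    obtain ⟨w0, hw0⟩ := hu1
    set d := cross u v with hd'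
    set w := w0 + (cross v w0 / d) • u with hw_def
    have hw : cross u w = 1 := by
      rw [← hw0, hw_def]; simp [cross]; ring
    have hk_eq : cross v w = cross v w0 % d := by
      have : cross v w = cross v w0 - d * (cross v w0 / d) := by
        rw [hw_def, hd']; simp [cross]; ring
      rw [this]; have := Int.mul_ediv_add_emod (cross v w0) d; omega
    set k := cross v w with hk
    have hd0 : 0 < d := by rw [hd]; positivity
    have hk0 : 0 ≤ k := hk_eq ▸ Int.emod_nonneg _ hd0.ne'
    have hkd : k < d := hk_eq ▸ Int.emod_lt_of_pos _ hd0
    have hv' : v = k • u + d • w := eq_coords hw v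
    have hcop : IsCoprime k d := by
      obtain ⟨y, hy⟩ := hv1
      rw [hv'] at hy
      exact isCoprime_of_isUnit_cross (p := u) (q := w) (y := y) (by rw [hy]; exact isUnit_one)
    rcases hk0.eq_or_lt with hk0 | hk0
    · have hd1 : d = 1 := by
        rw [← hk0, isCoprime_zero_left, Int.isUnit_iff] at hcop; omega
      have : v = w := by rw [hv', ← hk0, hd1]; module
      rw [this] at hv ⊢
      exact h.constSign_of_cross_eq_one hw hu hv
    have hw1 : ∃ y, cross w y = 1 := ⟨-u, by rw [cross_neg, cross_comm, neg_neg, hw]⟩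
    have cross_v : ∀ x, cross x v = cross x w * d - cross u x * k := by
      intro x
      conv_lhs => rw [hv']
      simp [cross]; ring
    by_cases hnw : NegType Ψ w
    · have hus : cross u (u + w) = 1 := by rw [← hw]; simp [cross]; ring
      by_cases hns : NegType Ψ (u + w)
      · exfalso
        have hun : IsUnit (cross w (u + w)) := by
          have : cross w (u + w) = -cross u w := by simp [cross]; ring
          rw [this, hw]; simp
        rcases h.mem_or hun with hS | hS
        · have := (h.climb_neg hns (negType_neg hnw) (by rwa [neg_neg, symProd_comm])).2.2
          rw [add_neg_cancel_right] at this
          exact hu this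
        · have := h.climb_neg_all hnw hns hS (i := d - k) (j := k) (by omega) (by omega) (by
            simpa [sub_eq_add_neg] using IsCoprime.add_mul_right_left hcop.symm (-1))
          rw [show (d - k) • w + k • (u + w) = k • u + d • w by module, ← hv'] at this
          exact hv this
      · have h1 := h.constSign_of_cross_eq_one hus hu hns
        have hsv : cross (u + w) v = d - k := by
          have : cross (u + w) v = d - cross v w := by rw [hd']; simp [cross]; ring
          rw [this]
        have h2 := ih (u + w) v (by omega) (by push_cast at hd; omega)
          ⟨-u, by rw [cross_neg, cross_comm, neg_neg, hus]⟩ hv1 hns hv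
        have h3 := h1.of_mul h2 (c := fun x => cross (u + w) x)
          (k := fun x => -(cross u x * cross x v)) ?_ ?_
        · simpa using h3.neg
        · intro x hx hc
          rw [eq_coords hus x] at hx
          have hcp := h.isCoprime_coords hx
          rw [cross_comm x, hc, neg_zero, isCoprime_zero_left, Int.isUnit_iff] at hcp
          rcases hcp with hb | hb
          · rw [cross_comm x, hc, hb] at hx
            exact hns (by simpa using hx)
          · rw [cross_comm x, hc, hb] at hx
            exact hns (negType_neg_iff.1 (by simpa [add_comm] using hx))
        · intro x
          have : cross x (u + w) = -cross (u + w) x := cross_comm _ _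
          rw [this]; ring
    · have h1 := h.constSign_of_cross_eq_one hw hu hnw
      have h2 := ih v w hk0.le (by push_cast at hd; omega) hv1 hw1 hv hnw
      have h3 := h1.of_mul h2 (c := fun x => cross x w)
        (k := fun x => -(cross u x * cross x v)) ?_ ?_
      · simpa using h3.neg
      · intro x hx hc
        rw [eq_coords hw x, hc] at hx
        have hcp := h.isCoprime_coords hx
        rw [isCoprime_zero_left, Int.isUnit_iff] at hcp
        rcases hcp with hb | hb
        · rw [hb] at hx
          exact hnw (by simpa using hx)
        · rw [hb] at hx
          exact hnw (negType_neg_iff.1 (by simpa using hx))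
      · intro x
        have : cross v x = -cross x v := cross_comm _ _
        simp only [this]; ring

end IsHalf

/-- The real linear form on the plane with coefficients `l`. -/
def planeForm (l : ℝ × ℝ) (x : ℤ × ℤ) : ℝ := l.1 * x.1 + l.2 * x.2

/-- The linear functional on `V` induced by the product of two linear forms on the plane. -/
def polar (l m : ℝ × ℝ) : V →ₗ[ℝ] ℝ where
  toFun v := (2 * l.1 * m.1) * v 1 + (l.1 * m.2 + l.2 * m.1) * (v 0 + v 1 - v 2) +
    (2 * l.2 * m.2) * v 0
  map_add' u v := by simp only [Pi.add_apply]; ring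
  map_smul' c v := by simp only [Pi.smul_apply, smul_eq_mul, RingHom.id_apply]; ring

lemma polar_symProd (l m : ℝ × ℝ) (p q : ℤ × ℤ) :
    polar l m (symProd p q) = planeForm l p * planeForm m q + planeForm l q * planeForm m p := by
  simp [polar, symProd, planeForm]
  ring

lemma polar_ne_zero {l m : ℝ × ℝ} (hl : l ≠ 0) (hm : m ≠ 0) : polar l m ≠ 0 := by
  intro h
  have h1 := LinearMap.congr_fun h ![0, 1, 1]
  have h2 := LinearMap.congr_fun h ![1, 0, 1]
  have h3 := LinearMap.congr_fun h ![0, 0, 1]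
  simp [polar] at h1 h2 h3
  obtain ⟨a, b⟩ := l
  obtain ⟨c, d⟩ := m
  simp only [ne_eq, Prod.mk_eq_zero, not_and_or] at hl hm h1 h2 h3
  rcases hl with hl | hl
  · have hc : c = 0 := h1.resolve_left hl
    subst hc
    have : d = 0 := by
      have h4 : a * d = 0 := by linarith
      exact (mul_eq_zero.1 h4).resolve_left hl
    simp [this] at hm
  · have hd : d = 0 := h2.resolve_left hl
    subst hd
    have : c = 0 := by
      have h4 : b * c = 0 := by linarith
      exact (mul_eq_zero.1 h4).resolve_left hl
    simp [this] at hm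

lemma exists_pos_abs_quadratic_lt {A D E : ℝ} (hE : 0 < E) (h : 4 * A * D < E ^ 2) :
    ∃ t : ℝ, 0 < t ∧ |A * t ^ 2 + D| < E * t := by
  rcases eq_or_ne A 0 with rfl | hA
  · refine ⟨(|D| + 1) / E, by positivity, ?_⟩
    rw [zero_mul, zero_add, mul_div_cancel₀ _ hE.ne']
    linarith
  rcases eq_or_ne D 0 with rfl | hD
  · have hA' : 0 < |A| := abs_pos.2 hA
    refine ⟨E / (2 * |A|), by positivity, ?_⟩
    rw [add_zero, abs_mul, abs_of_nonneg (sq_nonneg (E / (2 * |A|))), div_pow]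
    have : |A| * (E ^ 2 / (2 * |A|) ^ 2) = E * (E / (2 * |A|)) / 2 := by field_simp
    rw [this]
    have : 0 < E * (E / (2 * |A|)) := by positivity
    linarith
  · have hA' : 0 < |A| := abs_pos.2 hA
    have hD' : 0 < |D| := abs_pos.2 hD
    refine ⟨√(|D| / |A|), by positivity, ?_⟩
    have hsq : √(|D| / |A|) ^ 2 = |D| / |A| := Real.sq_sqrt (by positivity)
    have ht : 0 < √(|D| / |A|) := by positivity
    refine abs_lt_of_sq_lt_sq ?_ (by positivity)
    rw [mul_pow, hsq]
    have e : (A * (|D| / |A|) + D) ^ 2 = 2 * (|A| * |D| + A * D) * (|D| / |A|) := by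
      field_simp
      have h1 := sq_abs A
      have h2 := sq_abs D
      linear_combination (-D ^ 2) * h1 + (A ^ 2 - 2 * |A| ^ 2) * h2
    rw [e]
    refine mul_lt_mul_of_pos_right ?_ (by positivity)
    rcases le_total 0 (A * D) with hAD | hAD
    · rw [← abs_mul, abs_of_nonneg hAD]; linarith
    · rw [← abs_mul, abs_of_nonpos hAD]
      have : 0 < E ^ 2 := by positivity
      linarith

lemma exists_int_abs_quadratic_lt {A D E : ℝ} (hE : 0 < E) (h : 4 * A * D < E ^ 2) :
    ∃ i j : ℤ, 0 < i ∧ 0 < j ∧ IsCoprime i j ∧ |A * i ^ 2 + D * j ^ 2| < E * (i * j) := by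
  obtain ⟨t, ht0, ht⟩ := exists_pos_abs_quadratic_lt hE h
  have ho : IsOpen {t : ℝ | 0 < t ∧ |A * t ^ 2 + D| < E * t} :=
    (isOpen_lt continuous_const continuous_id).inter
      (isOpen_lt (f := fun t : ℝ => |A * t ^ 2 + D|) (g := fun t => E * t) (by fun_prop)
        (by fun_prop))
  obtain ⟨r, hr0, hr⟩ := Rat.denseRange_cast.exists_mem_open ho ⟨t, ht0, ht⟩
  have hr0 : 0 < r := by exact_mod_cast hr0
  have hd : (0 : ℝ) < r.den := by exact_mod_cast r.den_pos
  refine ⟨r.num, r.den, Rat.num_pos.2 hr0, by exact_mod_cast r.den_pos,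
    Int.isCoprime_iff_nat_coprime.2 (by simpa using r.reduced), ?_⟩
  have e : (r : ℝ) = r.num / r.den := Rat.cast_def r
  rw [e] at hr
  have e1 : A * (r.num : ℝ) ^ 2 + D * ((r.den : ℤ) : ℝ) ^ 2 =
      (A * ((r.num : ℝ) / r.den) ^ 2 + D) * (r.den : ℝ) ^ 2 := by
    push_cast; field_simp
  have e2 : E * (r.num * ((r.den : ℤ) : ℝ)) = E * ((r.num : ℝ) / r.den) * (r.den : ℝ) ^ 2 := by
    push_cast; field_simp
  rw [e1, e2, abs_mul, abs_of_nonneg (sq_nonneg (r.den : ℝ))]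
  exact mul_lt_mul_of_pos_right hr (by positivity)

/-- The linear form `c * a + d * b` for `a`, `b` the coordinates in the basis `u, w`. -/
def combForm (u w : ℤ × ℤ) (c d : ℝ) : ℝ × ℝ := (c * w.2 - d * u.2, d * u.1 - c * w.1)

lemma planeForm_combForm (u w : ℤ × ℤ) (c d : ℝ) (x : ℤ × ℤ) :
    planeForm (combForm u w c d) x = c * cross x w + d * cross u x := by
  simp [planeForm, combForm, cross]; ring

lemma combForm_det (u w : ℤ × ℤ) (c d c' d' : ℝ) :
    (combForm u w c d).1 * (combForm u w c' d').2 - (combForm u w c d).2 * (combForm u w c' d').1 =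
      (c * d' - d * c') * cross u w := by
  simp [combForm, cross]; ring

lemma exists_cross_combo_eq_one {p q : ℤ × ℤ} (h : IsUnit (cross p q)) {i j : ℤ}
    (hij : IsCoprime i j) : ∃ y, cross (i • p + j • q) y = 1 := by
  obtain ⟨a, b, hab⟩ := hij
  refine exists_cross_eq_one (y := (-b) • p + a • q) ?_
  rw [cross_combo, show i * a - j * -b = 1 by linarith, one_mul]
  exact h

namespace IsHalf

variable {Ψ : Set V}

lemma polar_nonneg (h : IsHalf Ψ) {l m : ℝ × ℝ} (hdet : l.1 * m.2 - l.2 * m.1 ≠ 0)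
    (hneg : ∀ x, NegType Ψ x → planeForm l x * planeForm m x ≤ 0)
    (hprim : ∀ x, (∃ y, cross x y = 1) → planeForm l x * planeForm m x < 0 → NegType Ψ x)
    {p q : ℤ × ℤ} (hpq : symProd p q ∈ Ψ) : 0 ≤ polar l m (symProd p q) := by
  rw [polar_symProd]
  by_contra! hlt
  have hu := h.isUnit hpq
  have hmap : ∀ (l : ℝ × ℝ) (i j : ℤ),
      planeForm l (i • p + j • q) = i * planeForm l p + j * planeForm l q := by
    intro l i j; simp [planeForm]; ring
  have hdisc : (planeForm l p * planeForm m q - planeForm l q * planeForm m p) =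
      (l.1 * m.2 - l.2 * m.1) * cross p q := by
    simp [planeForm, cross]; ring
  have hne : planeForm l p * planeForm m q - planeForm l q * planeForm m p ≠ 0 := by
    rw [hdisc]
    exact mul_ne_zero hdet (by exact_mod_cast hu.ne_zero)
  obtain ⟨i, j, hi, hj, hij, hlt'⟩ := exists_int_abs_quadratic_lt
    (A := planeForm l p * planeForm m p) (D := planeForm l q * planeForm m q) (neg_pos.2 hlt)
    (by have := sq_pos_of_ne_zero hne; linarith)
  obtain ⟨h1, h2⟩ := abs_lt.1 hlt'
  have hn : NegType Ψ (i • p + j • q) := by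
    refine hprim _ (exists_cross_combo_eq_one hu hij) ?_
    rw [hmap, hmap]; linarith
  have hn' := hneg _ (h.negType_reflect hpq hi hj hn)
  rw [show i • p - j • q = i • p + (-j) • q by module, hmap, hmap] at hn'
  push_cast at hn'
  linarith

lemma exists_form_of_cross_eq_zero (h : IsHalf Ψ) {x₁ : ℤ × ℤ} (hx₁ : NegType Ψ x₁)
    (hN : ∀ x, NegType Ψ x → cross x₁ x = 0) : ∃ f : V →ₗ[ℝ] ℝ, f ≠ 0 ∧ ∀ v ∈ Ψ, 0 ≤ f v := by
  have hne : combForm x₁ 0 0 1 ≠ 0 := by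
    intro hc
    obtain ⟨y, k, -, hy, -⟩ := hx₁
    have : planeForm (combForm x₁ 0 0 1) y = 0 := by rw [hc]; simp [planeForm]
    rw [planeForm_combForm] at this
    have := (h.isUnit hy).ne_zero
    simp_all
  refine ⟨polar _ _, polar_ne_zero hne hne, fun v hv => ?_⟩
  obtain ⟨p, q, hu, rfl⟩ := eq_symProd_of_mem_Φ (h.subset hv)
  rw [polar_symProd, planeForm_combForm, planeForm_combForm]
  by_contra! hlt
  obtain ⟨i, j, rfl⟩ := exists_coords hu x₁
  have hij : 0 < i * j := by
    have hlt' : 0 < -((cross (i • p + j • q) p : ℤ) * cross (i • p + j • q) q : ℝ) := by linarith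
    have e1 : cross (i • p + j • q) p = -(j * cross p q) := by simp [cross]; ring
    have e2 : cross (i • p + j • q) q = i * cross p q := by simp [cross]; ring
    have e3 : -(cross (i • p + j • q) p * cross (i • p + j • q) q) = i * j := by
      rw [e1, e2]; linear_combination (i * j) * isUnit_mul_self hu
    rw [← e3]; exact_mod_cast hlt'
  have fin : NegType Ψ (i • p - j • q) → False := by
    intro hn
    have := hN _ hn
    have e : cross (i • p + j • q) (i • p - j • q) = -2 * (i * j) * cross p q := by
      simp [cross]; ring
    rw [e] at this
    simp [hij.ne', hu.ne_zero] at this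
  rcases pos_and_pos_or_neg_and_neg_of_mul_pos hij with ⟨hi, hj⟩ | ⟨hi, hj⟩
  · exact fin (h.negType_reflect hv hi hj hx₁)
  · have := h.negType_reflect hv (neg_pos.2 hi) (neg_pos.2 hj)
      (by rw [show -i • p + -j • q = -(i • p + j • q) by module]; exact negType_neg hx₁)
    rw [show -i • p - -j • q = -(i • p - j • q) by module] at this
    exact fin (negType_neg_iff.1 this)

lemma exists_form_of_cross_ne_zero (h : IsHalf Ψ) {u : ℤ × ℤ} (hu1 : ∃ w, cross u w = 1)
    (hu : ¬ NegType Ψ u) (hN : ∀ x, (∃ y, cross x y = 1) → cross u x ≠ 0 → NegType Ψ x) :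
    ∃ f : V →ₗ[ℝ] ℝ, f ≠ 0 ∧ ∀ v ∈ Ψ, 0 ≤ f v := by
  have hne : combForm u 0 0 1 ≠ 0 := by
    intro hc
    obtain ⟨y, hy⟩ := hu1
    have : planeForm (combForm u 0 0 1) y = 0 := by rw [hc]; simp [planeForm]
    rw [planeForm_combForm, hy] at this
    simp at this
  refine ⟨-polar _ _, neg_ne_zero.2 (polar_ne_zero hne hne), fun v hv => ?_⟩
  obtain ⟨p, q, hpq, rfl⟩ := eq_symProd_of_mem_Φ (h.subset hv)
  rw [LinearMap.neg_apply, polar_symProd, planeForm_combForm, planeForm_combForm]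
  by_contra! hlt
  obtain ⟨y, hy⟩ := hu1
  obtain ⟨i, j, rfl⟩ := exists_coords hpq u
  have hcop : IsCoprime i j := isCoprime_of_isUnit_cross (p := p) (q := q) (y := y)
    (by rw [hy]; exact isUnit_one)
  have hij : 0 < i * -j := by
    have hlt' : 0 < ((cross (i • p + j • q) p : ℤ) * cross (i • p + j • q) q : ℝ) := by linarith
    have e1 : cross (i • p + j • q) p = -(j * cross p q) := by simp [cross]; ring
    have e2 : cross (i • p + j • q) q = i * cross p q := by simp [cross]; ring
    have e3 : cross (i • p + j • q) p * cross (i • p + j • q) q = i * -j := by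
      rw [e1, e2]; linear_combination (-(i * j)) * isUnit_mul_self hpq
    rw [← e3]; exact_mod_cast hlt'
  have hn : NegType Ψ (i • p + (-j) • q) := by
    refine hN _ (exists_cross_combo_eq_one hpq hcop.neg_right) ?_
    rw [cross_combo, show i * -j - j * i = 2 * (i * -j) by ring]
    exact mul_ne_zero (mul_ne_zero two_ne_zero hij.ne') hpq.ne_zero
  rcases pos_and_pos_or_neg_and_neg_of_mul_pos hij with ⟨hi, hj⟩ | ⟨hi, hj⟩
  · have := h.negType_reflect hv hi hj hn
    rw [show i • p - -j • q = i • p + j • q by module] at this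
    exact hu this
  · have := h.negType_reflect hv (neg_pos.2 hi) (neg_pos.2 hj)
      (by rw [show -i • p + -(-j) • q = -(i • p + -j • q) by module]; exact negType_neg hn)
    rw [show -i • p - -(-j) • q = -(i • p + j • q) by module] at this
    exact hu (negType_neg_iff.1 this)

/-- A half system having vectors both of negative type and not of negative type lies in a
half space. -/
lemma exists_form_of_negType (h : IsHalf Ψ) {u x₁ : ℤ × ℤ} (hu1 : ∃ w, cross u w = 1)
    (hu : ¬ NegType Ψ u) (hx₁ : NegType Ψ x₁) :
    ∃ f : V →ₗ[ℝ] ℝ, f ≠ 0 ∧ ∀ v ∈ Ψ, 0 ≤ f v := by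
  obtain ⟨w, hw⟩ := id hu1
  let t : ℤ × ℤ → ℝ := fun x => (cross x w : ℝ) / cross u x
  let T : Set ℝ := t '' {x | NegType Ψ x}
  have hb : ∀ x, NegType Ψ x → cross u x ≠ 0 := by
    intro x hx hc
    rw [eq_coords hw x, hc] at hx
    have hcp := h.isCoprime_coords hx
    rw [isCoprime_zero_right, Int.isUnit_iff] at hcp
    rcases hcp with ha | ha
    · rw [ha] at hx
      exact hu (by simpa using hx)
    · rw [ha] at hx
      exact hu (negType_neg_iff.1 (by simpa using hx))
  have ht : ∀ x, cross u x ≠ 0 → (cross x w : ℝ) = t x * cross u x := by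
    intro x hx
    have : (cross u x : ℝ) ≠ 0 := by exact_mod_cast hx
    simp only [t]
    field_simp
  have hbound : ∀ y, (∃ z, cross y z = 1) → ¬ NegType Ψ y → cross u y ≠ 0 →
      t y ∈ lowerBounds T ∨ t y ∈ upperBounds T := by
    intro y hy1 hy hby
    have e : ∀ x, NegType Ψ x → ((cross u x * cross x y : ℤ) : ℝ) =
        (cross u x : ℝ) ^ 2 * ((t x - t y) * cross u y) := by
      intro x hx
      have e1 : cross x y = cross x w * cross u y - cross u x * cross y w := by
        conv_lhs => rw [eq_coords hw x, eq_coords hw y, cross_combo, hw]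
        ring
      rw [e1]
      push_cast
      rw [ht x (hb x hx), ht y hby]
      ring
    have hpos : ∀ x, NegType Ψ x → (0 : ℝ) < (cross u x : ℝ) ^ 2 := by
      intro x hx
      have : (cross u x : ℝ) ≠ 0 := by exact_mod_cast hb x hx
      positivity
    have hby' : (cross u y : ℝ) ≠ 0 := by exact_mod_cast hby
    rcases h.constSign hu1 hy1 hu hy with hs | hs
    · have h1 : ∀ x, NegType Ψ x → 0 ≤ (t x - t y) * cross u y := by
        intro x hx
        have : (0 : ℝ) ≤ ((cross u x * cross x y : ℤ) : ℝ) := by exact_mod_cast hs x hx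
        rw [e x hx] at this
        exact nonneg_of_mul_nonneg_right this (hpos x hx)
      rcases lt_or_gt_of_ne hby' with hlt | hlt
      · right
        rintro _ ⟨x, hx, rfl⟩
        have := nonpos_of_mul_nonneg_left (h1 x hx) hlt
        linarith
      · left
        rintro _ ⟨x, hx, rfl⟩
        have := nonneg_of_mul_nonneg_left (h1 x hx) hlt
        linarith
    · have h1 : ∀ x, NegType Ψ x → (t x - t y) * cross u y ≤ 0 := by
        intro x hx
        have : ((cross u x * cross x y : ℤ) : ℝ) ≤ 0 := by exact_mod_cast hs x hx
        rw [e x hx] at this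
        exact nonpos_of_mul_nonpos_right this (hpos x hx)
      rcases lt_or_gt_of_ne hby' with hlt | hlt
      · left
        rintro _ ⟨x, hx, rfl⟩
        have := nonneg_of_mul_nonpos_left (h1 x hx) hlt
        linarith
      · right
        rintro _ ⟨x, hx, rfl⟩
        have := nonpos_of_mul_nonpos_left (h1 x hx) hlt
        linarith
  have hTne : T.Nonempty := ⟨_, x₁, hx₁, rfl⟩
  have build : ∀ c d c' d' : ℝ, c * d' - d * c' ≠ 0 →
      (∀ x, NegType Ψ x → (c * t x + d) * (c' * t x + d') ≤ 0) →
      (∀ x, cross u x = 0 → 0 ≤ c * c') →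
      (∀ x, cross u x ≠ 0 → (t x ∈ lowerBounds T ∨ t x ∈ upperBounds T) →
        0 ≤ (c * t x + d) * (c' * t x + d')) →
      ∃ f : V →ₗ[ℝ] ℝ, f ≠ 0 ∧ ∀ v ∈ Ψ, 0 ≤ f v := by
    intro c d c' d' hdet h1 h2 h3
    have hdet' := combForm_det u w c d c' d'
    rw [hw, Int.cast_one, mul_one] at hdet'
    have e : ∀ x, cross u x ≠ 0 →
        planeForm (combForm u w c d) x * planeForm (combForm u w c' d') x =
        ((c * t x + d) * (c' * t x + d')) * (cross u x : ℝ) ^ 2 := by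
      intro x hx
      rw [planeForm_combForm, planeForm_combForm, ht x hx]
      ring
    refine ⟨polar (combForm u w c d) (combForm u w c' d'), polar_ne_zero ?_ ?_, ?_⟩
    · rintro hc; rw [hc] at hdet'; simp at hdet'; exact hdet hdet'.symm
    · rintro hc; rw [hc] at hdet'; simp at hdet'; exact hdet hdet'.symm
    · intro v hv
      obtain ⟨p, q, -, rfl⟩ := eq_symProd_of_mem_Φ (h.subset hv)
      refine h.polar_nonneg (by rwa [hdet']) ?_ ?_ hv
      · intro x hx
        rw [e x (hb x hx)]
        exact mul_nonpos_of_nonpos_of_nonneg (h1 x hx) (sq_nonneg _)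
      · intro x hx1 hlt
        by_contra hx
        refine hlt.not_ge ?_
        rcases eq_or_ne (cross u x) 0 with hx0 | hx0
        · rw [planeForm_combForm, planeForm_combForm, hx0, Int.cast_zero, mul_zero, mul_zero,
            add_zero, add_zero]
          have := mul_nonneg (h2 x hx0) (sq_nonneg (cross x w : ℝ))
          linarith
        · rw [e x hx0]
          exact mul_nonneg (h3 x hx0 (hbound x hx1 hx hx0)) (sq_nonneg _)
  by_cases hlo : BddBelow T <;> by_cases hup : BddAbove T
  · rcases (csInf_le_csSup hTne hlo hup).lt_or_eq with hlt | heq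
    · refine build 1 (-sInf T) 1 (-sSup T) (by linarith) ?_ (by simp) ?_
      · intro x hx
        have := csInf_le hlo ⟨x, hx, rfl⟩
        have := le_csSup hup ⟨x, hx, rfl⟩
        exact mul_nonpos_of_nonneg_of_nonpos (by linarith) (by linarith)
      · rintro x - (hx | hx)
        · have := le_csInf hTne hx
          exact mul_nonneg_of_nonpos_of_nonpos (by linarith) (by linarith)
        · have := csSup_le hTne hx
          exact mul_nonneg (by linarith) (by linarith)
    · refine h.exists_form_of_cross_eq_zero hx₁ fun x hx => ?_
      have hteq : t x₁ = t x := by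
        have h1 := csInf_le hlo ⟨x, hx, rfl⟩
        have h2 := le_csSup hup ⟨x, hx, rfl⟩
        have h3 := csInf_le hlo ⟨x₁, hx₁, rfl⟩
        have h4 := le_csSup hup ⟨x₁, hx₁, rfl⟩
        linarith
      have e1 : cross x₁ x = cross x₁ w * cross u x - cross u x₁ * cross x w := by
        conv_lhs => rw [eq_coords hw x₁, eq_coords hw x, cross_combo, hw]
        ring
      have : (cross x₁ x : ℝ) = 0 := by
        rw [e1]
        push_cast
        rw [ht x (hb x hx), ht x₁ (hb x₁ hx₁), hteq]
        ring
      exact_mod_cast this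
  · refine build (-1) (sInf T) 0 1 (by norm_num) ?_ (by simp) ?_
    · intro x hx
      have := csInf_le hlo ⟨x, hx, rfl⟩
      linarith
    · rintro x - (hx | hx)
      · have := le_csInf hTne hx
        linarith
      · exact (hup ⟨_, hx⟩).elim
  · refine build 1 (-sSup T) 0 1 (by norm_num) ?_ (by simp) ?_
    · intro x hx
      have := le_csSup hup ⟨x, hx, rfl⟩
      linarith
    · rintro x - (hx | hx)
      · exact (hlo ⟨_, hx⟩).elim
      · have := csSup_le hTne hx
        linarith
  · refine h.exists_form_of_cross_ne_zero hu1 hu fun x hx1 hx0 => ?_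
    by_contra hx
    rcases hbound x hx1 hx hx0 with hc | hc
    · exact hlo ⟨_, hc⟩
    · exact hup ⟨_, hc⟩

end IsHalf

lemma int_sign {i j k l : ℤ} (h : IsUnit (i * l - j * k)) :
    (0 ≤ j * l ∧ 0 ≤ i * k ∧ 0 ≤ (i - j) * (k - l)) ∨
      (j * l ≤ 0 ∧ i * k ≤ 0 ∧ (i - j) * (k - l) ≤ 0) := by
  have e0 : symProd (i, j) (k, l) 0 = ((j * l : ℤ) : ℝ) := by simp [symProd]
  have e1 : symProd (i, j) (k, l) 1 = ((i * k : ℤ) : ℝ) := by simp [symProd]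
  have e2 : symProd (i, j) (k, l) 2 = (((i - j) * (k - l) : ℤ) : ℝ) := by simp [symProd]
  rcases symProd_sign (x := (i, j)) (y := (k, l)) h with hs | hs
  · have h0 := hs 0
    have h1 := hs 1
    have h2 := hs 2
    rw [e0] at h0; rw [e1] at h1; rw [e2] at h2
    exact .inl ⟨by exact_mod_cast h0, by exact_mod_cast h1, by exact_mod_cast h2⟩
  · have h0 := hs 0
    have h1 := hs 1
    have h2 := hs 2
    rw [e0] at h0; rw [e1] at h1; rw [e2] at h2
    exact .inr ⟨by exact_mod_cast h0, by exact_mod_cast h1, by exact_mod_cast h2⟩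

lemma sign_opposite {a b : ℤ} (h : a * b ≤ 0) : (0 ≤ a ∧ b ≤ 0) ∨ (a ≤ 0 ∧ 0 ≤ b) := by
  rcases mul_nonpos_iff.1 h with h | h <;> simp [h]

lemma sector_cases {i j k l : ℤ} (h : IsUnit (i * l - j * k)) (h1 : j * l ≤ 0) (h2 : i * k ≤ 0)
    (h3 : (i - j) * (k - l) ≤ 0) :
    ((0 ≤ i ∧ 0 ≤ -j ∧ 0 ≤ -k ∧ 0 ≤ l) ∨ (i ≤ 0 ∧ -j ≤ 0 ∧ -k ≤ 0 ∧ l ≤ 0)) ∨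
    ((0 ≤ j - i ∧ 0 ≤ i ∧ 0 ≤ k - l ∧ 0 ≤ -k) ∨ (j - i ≤ 0 ∧ i ≤ 0 ∧ k - l ≤ 0 ∧ -k ≤ 0)) ∨
    ((0 ≤ i - j ∧ 0 ≤ j ∧ 0 ≤ l - k ∧ 0 ≤ -l) ∨ (i - j ≤ 0 ∧ j ≤ 0 ∧ l - k ≤ 0 ∧ -l ≤ 0)) := by
  have n1 : ¬ (i = 0 ∧ j = 0) := by rintro ⟨rfl, rfl⟩; simp at h
  have n2 : ¬ (k = 0 ∧ l = 0) := by rintro ⟨rfl, rfl⟩; simp at h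
  have n3 : ¬ (i = 0 ∧ k = 0) := by rintro ⟨rfl, rfl⟩; simp at h
  have n4 : ¬ (j = 0 ∧ l = 0) := by rintro ⟨rfl, rfl⟩; simp at h
  have n5 : ¬ (i = j ∧ k = l) := by rintro ⟨rfl, rfl⟩; simp at h
  rcases sign_opposite h1 with ⟨h1, h1'⟩ | ⟨h1, h1'⟩ <;>
    rcases sign_opposite h2 with ⟨h2, h2'⟩ | ⟨h2, h2'⟩ <;>
    rcases sign_opposite h3 with ⟨h3, h3'⟩ | ⟨h3, h3'⟩ <;> omega

/-- The height of `symProd p q` with respect to the simple roots attached to a basis `x, y`. -/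
def basisHeight (x y p q : ℤ × ℤ) : ℤ :=
  2 * (cross p y * cross q y) + 2 * (cross x p * cross x q) - cross p y * cross x q -
    cross x p * cross q y

lemma exists_basisHeight_form {x y : ℤ × ℤ} (h : cross x y = 1) :
    ∃ f : V →ₗ[ℝ] ℝ, f ≠ 0 ∧ ∀ p q, f (symProd p q) = basisHeight x y p q := by
  have key : ∀ p q, (polar (combForm x y 1 0) (combForm x y 1 0) +
      polar (combForm x y 0 1) (combForm x y 0 1) -
      polar (combForm x y 1 0) (combForm x y 0 1)) (symProd p q) = basisHeight x y p q := by
    intro p q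
    simp only [LinearMap.sub_apply, LinearMap.add_apply, polar_symProd, planeForm_combForm,
      basisHeight]
    push_cast
    ring
  refine ⟨_, fun h0 => ?_, key⟩
  have := key x y
  rw [h0] at this
  have hs : ∀ z, cross z z = 0 := fun z => by simp [cross]; ring
  simp [basisHeight, h, hs] at this

namespace IsHalf

variable {Ψ : Set V}

lemma notMem_of_sector (h : IsHalf Ψ) (hN : ∀ x, ¬ NegType Ψ x) {P Q : ℤ × ℤ}
    (hPQ : symProd P Q ∈ Ψ) {i j k l : ℤ}
    (hs : (0 ≤ i ∧ 0 ≤ j ∧ 0 ≤ k ∧ 0 ≤ l) ∨ (i ≤ 0 ∧ j ≤ 0 ∧ k ≤ 0 ∧ l ≤ 0))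
    (hu : IsUnit (i * l - j * k)) : symProd (i • P + j • Q) (-(k • P + l • Q)) ∉ Ψ := by
  intro hc
  refine h.absurd ?_ hc
  rcases hs with ⟨hi, hj, hk, hl⟩ | ⟨hi, hj, hk, hl⟩
  · exact h.climb_edge (hN _) (hN _) hPQ hi hj hk hl hu
  · have := h.climb_edge (hN _) (hN _) hPQ (neg_nonneg.2 hi) (neg_nonneg.2 hj) (neg_nonneg.2 hk)
      (neg_nonneg.2 hl) (by simpa using hu)
    rw [← symProd_neg_neg]
    convert this using 2 <;> module

lemma basisHeight_neg_cases (h : IsHalf Ψ) (hN : ∀ x, ¬ NegType Ψ x) {x y p q : ℤ × ℤ}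
    (hxy : cross x y = 1) (hpq : symProd p q ∈ Ψ) (hlt : basisHeight x y p q < 0) :
    (0 < cross p y * cross x q + cross x p * cross q y ∧ symProd x y ∈ Ψ) ∨
      symProd y (-(x + y)) ∈ Ψ ∨ symProd x (-(x + y)) ∈ Ψ := by
  have hp := eq_coords hxy p
  have hq := eq_coords hxy q
  have hu := h.isUnit hpq
  rw [hp, hq, cross_combo, hxy, mul_one] at hu
  rw [basisHeight] at hlt
  rw [hp, hq] at hpq
  clear hp hq
  generalize cross p y = i at *
  generalize cross x p = j at *
  generalize cross q y = k at *
  generalize cross x q = l at *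
  have hsgn : j * l ≤ 0 ∧ i * k ≤ 0 ∧ (i - j) * (k - l) ≤ 0 := by
    refine (int_sign hu).resolve_left ?_
    rintro ⟨h1, h2, h3⟩
    linarith
  rcases sector_cases hu hsgn.1 hsgn.2.1 hsgn.2.2 with hs | hs | hs
  · left
    constructor
    · have h1 : 0 ≤ i * l := by
        rcases hs with hs | hs
        · exact mul_nonneg hs.1 hs.2.2.2
        · exact mul_nonneg_of_nonpos_of_nonpos hs.1 hs.2.2.2
      have h2 : 0 ≤ j * k := by
        rcases hs with hs | hs
        · exact mul_nonneg_of_nonpos_of_nonpos (by omega) (by omega)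
        · exact mul_nonneg (by omega) (by omega)
      rw [Int.isUnit_iff] at hu
      rcases hu with hu | hu <;> linarith
    · by_contra hc
      rw [h.notMem_iff (by simp [hxy])] at hc
      refine h.notMem_of_sector hN hc hs (by convert hu using 1; ring) ?_
      convert hpq using 2 <;> module
  · right; left
    by_contra hc
    rw [← h.notMem_iff, not_not] at hc
    · refine h.notMem_of_sector hN hc hs ?_ ?_
      · convert hu using 1; ring
      · convert hpq using 2 <;> module
    · have : cross y (x + y) = -cross x y := by simp [cross]; ring
      simp [this, hxy]
  · right; right
    by_contra hc
    rw [← h.notMem_iff, not_not] at hc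
    · refine h.notMem_of_sector hN hc hs ?_ ?_
      · rw [← IsUnit.neg_iff]; convert hu using 1; ring
      · convert hpq using 2 <;> module
    · have : cross x (x + y) = cross x y := by simp [cross]; ring
      simp [this, hxy]

lemma basisHeight_reflect (h : IsHalf Ψ) (hN : ∀ x, ¬ NegType Ψ x) {x y p q : ℤ × ℤ}
    (hxy : cross x y = 1) (hS : symProd x y ∈ Ψ) (hpq : symProd p q ∈ Ψ) :
    (basisHeight x y p q < 0 → basisHeight x y p q < basisHeight (-y) x p q) ∧
      (0 ≤ basisHeight x y p q → 0 ≤ basisHeight (-y) x p q) := by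
  have hht : basisHeight (-y) x p q = 2 * (cross p y * cross q y) + 2 * (cross x p * cross x q) +
      cross p y * cross x q + cross x p * cross q y := by
    simp [basisHeight, cross]; ring
  constructor
  · intro hlt
    rcases h.basisHeight_neg_cases hN hxy hpq hlt with ⟨hc, -⟩ | hc | hc
    · rw [hht, basisHeight]; linarith
    · refine (hN y ⟨x, 1, one_pos, by rwa [symProd_comm], ?_⟩).elim
      rwa [show -((1 : ℤ) • y) - x = -(x + y) by module]
    · refine (hN x ⟨y, 1, one_pos, hS, ?_⟩).elim
      rwa [show -((1 : ℤ) • x) - y = -(x + y) by module]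
  · intro h0
    by_contra! hlt
    have hp := eq_coords hxy p
    have hq := eq_coords hxy q
    have hu := h.isUnit hpq
    rw [hp, hq, cross_combo, hxy, mul_one] at hu
    rw [hht] at hlt
    rw [basisHeight] at h0
    rw [hp, hq] at hpq
    clear hp hq hht
    generalize cross p y = i at *
    generalize cross x p = j at *
    generalize cross q y = k at *
    generalize cross x q = l at *
    obtain ⟨h1, h2, h3⟩ : 0 ≤ j * l ∧ 0 ≤ i * k ∧ 0 ≤ (i - j) * (k - l) := by
      refine (int_sign hu).resolve_right ?_
      rintro ⟨h1, h2, h3⟩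
      have h4 : i * k = 0 := by linarith
      have h5 : j * l = 0 := by linarith
      have h6 : (i - j) * (k - l) = 0 := by linarith
      linarith
    obtain ⟨h4, h5, h6⟩ : -j * -l ≤ 0 ∧ i * k ≤ 0 ∧ (i - -j) * (k - -l) ≤ 0 := by
      refine (int_sign (i := i) (j := -j) (k := k) (l := -l) ?_).resolve_left ?_
      · rw [← IsUnit.neg_iff]; convert hu using 1; ring
      · rintro ⟨h4, h5, h6⟩
        linarith
    have h7 : j * l = 0 := by linarith
    have h8 : i * k = 0 := by linarith
    rw [h7, h8] at hlt
    rcases mul_eq_zero.1 h7 with rfl | rfl <;> rcases mul_eq_zero.1 h8 with rfl | rfl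
    · simp at hu
    · have : i * l = -1 := by
        rw [Int.isUnit_iff] at hu; omega
      rcases Int.mul_eq_neg_one_iff_eq_one_or_neg_one.1 this with ⟨rfl, rfl⟩ | ⟨rfl, rfl⟩
      · exact h.absurd hS (by simpa using hpq)
      · refine h.absurd hS ?_
        rw [← symProd_neg_neg]; simpa using hpq
    · have : j * k = -1 := by
        rw [Int.isUnit_iff] at hu; omega
      rw [symProd_comm] at hS
      rcases Int.mul_eq_neg_one_iff_eq_one_or_neg_one.1 this with ⟨rfl, rfl⟩ | ⟨rfl, rfl⟩
      · exact h.absurd hS (by simpa using hpq)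
      · refine h.absurd hS ?_
        rw [← symProd_neg_neg]; simpa using hpq
    · simp at hu

lemma basisHeight_rotate (x y p q : ℤ × ℤ) :
    basisHeight y (-(x + y)) p q = basisHeight x y p q := by
  simp [basisHeight, cross]; ring

/-- A finite part of a half system without vectors of negative type lies in a half space. -/
lemma exists_form_of_forall_not_negType (h : IsHalf Ψ) (hN : ∀ x, ¬ NegType Ψ x)
    (G : Finset ((ℤ × ℤ) × (ℤ × ℤ))) (hG : ∀ g ∈ G, symProd g.1 g.2 ∈ Ψ) :
    ∃ f : V →ₗ[ℝ] ℝ, f ≠ 0 ∧ ∀ g ∈ G, 0 ≤ f (symProd g.1 g.2) := by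
  suffices key : ∀ (n : ℕ) (x y : ℤ × ℤ), cross x y = 1 →
      ∑ g ∈ G, (-basisHeight x y g.1 g.2).toNat ≤ n →
      ∃ f : V →ₗ[ℝ] ℝ, f ≠ 0 ∧ ∀ g ∈ G, 0 ≤ f (symProd g.1 g.2) from
    key _ (1, 0) (0, 1) (by simp [cross]) le_rfl
  intro n
  induction n using Nat.strong_induction_on with
  | _ n ih =>
    intro x y hxy hn
    by_cases hall : ∀ g ∈ G, 0 ≤ basisHeight x y g.1 g.2
    · obtain ⟨f, hf0, hf⟩ := exists_basisHeight_form hxy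
      exact ⟨f, hf0, fun g hg => by rw [hf]; exact_mod_cast hall g hg⟩
    push Not at hall
    obtain ⟨g₀, hg₀, hlt₀⟩ := hall
    have step : ∀ x y : ℤ × ℤ, cross x y = 1 → symProd x y ∈ Ψ →
        basisHeight x y g₀.1 g₀.2 < 0 → ∑ g ∈ G, (-basisHeight x y g.1 g.2).toNat ≤ n →
        ∃ f : V →ₗ[ℝ] ℝ, f ≠ 0 ∧ ∀ g ∈ G, 0 ≤ f (symProd g.1 g.2) := by
      intro x y hxy hS hlt hn
      refine ih _ ?_ (-y) x (by rw [← hxy]; simp [cross]; ring) le_rfl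
      refine lt_of_lt_of_le (Finset.sum_lt_sum (fun g hg => ?_) ⟨g₀, hg₀, ?_⟩) hn
      · have := h.basisHeight_reflect hN hxy hS (hG g hg)
        omega
      · have := h.basisHeight_reflect hN hxy hS (hG g₀ hg₀)
        omega
    have hyz : cross y (-(x + y)) = 1 := by rw [← hxy]; simp [cross]; ring
    rcases h.basisHeight_neg_cases hN hxy (hG g₀ hg₀) hlt₀ with ⟨-, hc⟩ | hc | hc
    · exact step x y hxy hc hlt₀ hn
    · exact step y (-(x + y)) hyz hc (by rwa [basisHeight_rotate])
        (by simpa only [basisHeight_rotate] using hn)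
    · have hz : -(y + -(x + y)) = x := by module
      refine step (-(x + y)) x ?_ (by rwa [symProd_comm]) ?_ ?_
      · rw [← hxy]; simp [cross]; ring
      · have := basisHeight_rotate y (-(x + y)) g₀.1 g₀.2
        rw [hz, basisHeight_rotate] at this
        rwa [this]
      · have : ∀ p q, basisHeight (-(x + y)) x p q = basisHeight x y p q := by
          intro p q
          have := basisHeight_rotate y (-(x + y)) p q
          rwa [hz, basisHeight_rotate] at this
        simpa only [this] using hn

lemma not_negType_neg (h : IsHalf Ψ) {x : ℤ × ℤ} (hx : NegType Ψ x) :
    ¬ NegType {v | -v ∈ Ψ} x := by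
  rintro ⟨y', k', hk', h1', h2'⟩
  obtain ⟨y, k, hk, h1, h2⟩ := hx
  rw [Set.mem_ofPred_eq, ← symProd_neg] at h1' h2'
  have hneg : IsUnit (cross x (-y')) := h.isUnit h1'
  have hu : ∀ j : ℤ, IsUnit (cross x (y' + j • x)) := by
    intro j
    have : cross x (y' + j • x) = -cross x (-y') := by simp [cross]; ring
    rw [this]; exact hneg.neg
  have hu' : ∀ j : ℤ, IsUnit (cross x (-(y' + j • x))) := by
    intro j
    rw [cross_neg]; exact (hu j).neg
  obtain ⟨j, rfl | rfl⟩ := eq_add_smul_of_isUnit (by simpa using hu 0) (h.isUnit h1)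
  · rcases le_or_gt 0 j with hj | hj
    · exact h.absurd h1 (h.fan h1' h2 (s := k) (t := j) (n := k + j) hk.le hj (by linarith)
        (by module) (hu' j))
    · refine h.absurd (h.fan h1 h2' (s := k') (t := -j) (n := k' - j) hk'.le (by linarith)
        (by linarith) ?_ (hu 0)) (by simpa using h1')
      module
  · rcases le_or_gt 0 j with hj | hj
    · refine h.absurd (h.fan h2 h2' (s := k' + j) (t := k) (n := k' + k + j) (by linarith) hk.le
        (by linarith) ?_ (hu (-j))) (by convert h1 using 2; module)
      module
    rcases le_or_gt 0 (k + j) with hkj | hkj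
    · refine h.absurd (h.fan h2 h2' (s := k') (t := k + j) (n := k' + k + j) hk'.le hkj
        (by linarith) ?_ (hu 0)) (by simpa using h1')
      module
    · refine h.absurd h2 (h.fan h1 h1' (s := -(k + j)) (t := k) (n := -j) (by linarith) hk.le
        (by linarith) ?_ ?_)
      · module
      · convert hu' (-(k + j)) using 2; module

/-- A finite part of a half system lies in a half space. -/
lemma exists_form (h : IsHalf Ψ) (F : Finset V) (hF : ∀ v ∈ F, v ∈ Ψ) :
    ∃ f : V →ₗ[ℝ] ℝ, f ≠ 0 ∧ ∀ v ∈ F, 0 ≤ f v := by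
  classical
  have of_pos : ∀ {Ψ : Set V}, IsHalf Ψ → (∀ x, ¬ NegType Ψ x) → ∀ F : Finset V,
      (∀ v ∈ F, v ∈ Ψ) → ∃ f : V →ₗ[ℝ] ℝ, f ≠ 0 ∧ ∀ v ∈ F, 0 ≤ f v := by
    intro Ψ h hN F hF
    have hrep : ∀ v : V, ∃ g : (ℤ × ℤ) × (ℤ × ℤ), v ∈ Ψ → v = symProd g.1 g.2 := by
      intro v
      by_cases hv : v ∈ Ψ
      · obtain ⟨x, y, -, e⟩ := eq_symProd_of_mem_Φ (h.subset hv)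
        exact ⟨(x, y), fun _ => e⟩
      · exact ⟨0, fun hc => (hv hc).elim⟩
    choose g hg using hrep
    obtain ⟨f, hf0, hf⟩ := h.exists_form_of_forall_not_negType hN (F.image g) (by
      intro w hw
      obtain ⟨v, hv, rfl⟩ := Finset.mem_image.1 hw
      rw [← hg v (hF v hv)]
      exact hF v hv)
    refine ⟨f, hf0, fun v hv => ?_⟩
    rw [hg v (hF v hv)]
    exact hf _ (Finset.mem_image_of_mem g hv)
  by_cases hN : ∀ x, ¬ NegType Ψ x
  · exact of_pos h hN F hF
  push Not at hN
  obtain ⟨x₁, hx₁⟩ := hN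
  by_cases hu : ∃ u, (∃ w, cross u w = 1) ∧ ¬ NegType Ψ u
  · obtain ⟨u, hu1, hu⟩ := hu
    obtain ⟨f, hf0, hf⟩ := h.exists_form_of_negType hu1 hu hx₁
    exact ⟨f, hf0, fun v hv => hf v (hF v hv)⟩
  push Not at hu
  obtain ⟨f, hf0, hf⟩ := of_pos h.neg (fun x hx => by
    have hx' := hx
    obtain ⟨y, -, -, hy, -⟩ := hx'
    have hun : IsUnit (cross x y) := h.neg.isUnit hy
    exact h.not_negType_neg (hu x (exists_cross_eq_one hun)) hx) (F.image (-·)) (by simpa using hF)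
  exact ⟨-f, neg_ne_zero.2 hf0, fun v hv => by simpa using hf (-v) (Finset.mem_image_of_mem _ hv)⟩

end IsHalf

/-- A nontrivial positive relation of which a proper part is linearly dependent
can be shortened. -/
lemma exists_shorter_relation {E : Type*} [AddCommGroup E] [Module ℝ E] {t : Finset E} {c : E → ℝ}
    (hc : ∀ v ∈ t, 0 < c v) (hsum : ∑ v ∈ t, c v • v = 0) {v₀ : E} (hv₀ : v₀ ∈ t) {d : E → ℝ}
    (hd0 : d v₀ = 0) (hd : ∑ v ∈ t, d v • v = 0) {v₁ : E} (hv₁ : v₁ ∈ t) (hd1 : 0 < d v₁) :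
    ∃ t' ⊂ t, t'.Nonempty ∧ ∃ c' : E → ℝ, (∀ v ∈ t', 0 < c' v) ∧ ∑ v ∈ t', c' v • v = 0 := by
  classical
  obtain ⟨m, hm, hmin⟩ := (t.filter (0 < d ·)).exists_min_image (fun v => c v / d v)
    ⟨v₁, Finset.mem_filter.2 ⟨hv₁, hd1⟩⟩
  rw [Finset.mem_filter] at hm
  set r := c m / d m with hr
  have hr0 : 0 < r := div_pos (hc m hm.1) hm.2
  have hnn : ∀ v ∈ t, 0 ≤ c v - r * d v := by
    intro v hv
    rcases lt_or_ge 0 (d v) with h | h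
    · have := hmin v (Finset.mem_filter.2 ⟨hv, h⟩)
      rw [le_div_iff₀ h] at this
      linarith
    · nlinarith [hc v hv]
  refine ⟨t.filter (fun v => c v - r * d v ≠ 0), ?_, ⟨v₀, ?_⟩, fun v => c v - r * d v, ?_, ?_⟩
  · refine Finset.filter_ssubset.2 ⟨m, hm.1, ?_⟩
    rw [hr, div_mul_cancel₀ _ hm.2.ne']
    simp
  · simp [hv₀, hd0, (hc v₀ hv₀).ne']
  · intro v hv
    rw [Finset.mem_filter] at hv
    exact lt_of_le_of_ne (hnn v hv.1) hv.2.symm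
  · rw [Finset.sum_filter_of_ne (p := fun v => c v - r * d v ≠ 0)]
    · simp only [sub_smul, mul_smul, Finset.sum_sub_distrib, ← Finset.smul_sum, hsum, hd]
      simp
    · rintro v - h hz
      exact h (by simp only [hz, zero_smul])

lemma exists_dependence {t : Finset V} (ht : 3 ≤ t.card) {f : V →ₗ[ℝ] ℝ} (hf : f ≠ 0)
    (h : ∀ v ∈ t, f v = 0) : ∃ d : V → ℝ, ∑ v ∈ t, d v • v = 0 ∧ ∃ v ∈ t, 0 < d v := by
  have hdep : ¬ LinearIndepOn ℝ id (t : Set V) := by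
    intro hli
    have h1 := finrank_span_finset_eq_card hli
    have h2 : Submodule.span ℝ (t : Set V) ≤ LinearMap.ker f := Submodule.span_le.2 h
    have h3 := Submodule.finrank_mono h2
    have h4 := Module.Dual.finrank_ker_add_one_of_ne_zero (f := f) hf
    have h5 : Module.finrank ℝ V = 3 := by simp
    omega
  rw [linearIndepOn_finset_iff] at hdep
  push Not at hdep
  obtain ⟨d, hd, v, hv, hne⟩ := hdep
  rcases lt_or_gt_of_ne hne with hlt | hlt
  · refine ⟨fun v => -d v, ?_, v, hv, by simpa using hlt⟩
    simpa using hd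
  · exact ⟨d, by simpa using hd, v, hv, hlt⟩

namespace IsHalf

variable {Ψ : Set V}

lemma eq_empty_of_relation (h : IsHalf Ψ) (t : Finset V) (ht : ∀ v ∈ t, v ∈ Ψ) (c : V → ℝ)
    (hc : ∀ v ∈ t, 0 < c v) (hsum : ∑ v ∈ t, c v • v = 0) : t = ∅ := by
  classical
  induction t using Finset.strongInduction generalizing c with
  | H t ih =>
    by_contra hne
    have absurd3 : ∀ u ∈ Ψ, ∀ v ∈ Ψ, ∀ w ∈ Ψ, ∀ r s q : ℝ, 0 ≤ r → 0 ≤ s → 0 < q →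
        r • u + s • v + q • w = 0 → False := by
      intro u hu v hv w hw r s q hr hs hq e
      have e' : -w = (r / q) • u + (s / q) • v := by
        have : q • w = -(r • u + s • v) := by rw [eq_neg_iff_add_eq_zero, ← e]; abel
        have h2 : w = q⁻¹ • (q • w) := by rw [smul_smul, inv_mul_cancel₀ hq.ne', one_smul]
        rw [h2, this]
        module
      have := h.combo_mem u hu v hv (r / q) (s / q) (by positivity) (by positivity)
      rw [← e'] at this
      exact h.neg_notMem w hw (this (neg_mem_Φ (h.subset hw)))
    obtain ⟨v₀, hv₀⟩ := Finset.nonempty_iff_ne_empty.2 hne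
    have hcard := Finset.card_erase_add_one hv₀
    rcases le_or_gt 3 (t.erase v₀).card with h3 | h3
    · obtain ⟨f, hf0, hf⟩ := h.exists_form t ht
      have hfs : ∑ v ∈ t, c v * f v = 0 := by
        have := congrArg f hsum
        simpa using this
      rw [Finset.sum_eq_zero_iff_of_nonneg fun v hv => mul_nonneg (hc v hv).le (hf v hv)] at hfs
      have hf' : ∀ v ∈ t, f v = 0 := fun v hv =>
        (mul_eq_zero.1 (hfs v hv)).resolve_left (hc v hv).ne'
      obtain ⟨d, hd, v₁, hv₁, hd1⟩ := exists_dependence h3 hf0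
        fun v hv => hf' v (Finset.mem_of_mem_erase hv)
      obtain ⟨t', hss, hne', c', hc', hsum'⟩ := exists_shorter_relation hc hsum hv₀
        (d := Function.update d v₀ 0) (by simp)
        (by
          rw [← Finset.add_sum_erase _ _ hv₀, ← hd]
          simp only [Function.update_self, zero_smul, zero_add]
          exact Finset.sum_congr rfl fun v hv => by
            rw [Function.update_of_ne (Finset.ne_of_mem_erase hv)])
        (Finset.mem_of_mem_erase hv₁)
        (by rwa [Function.update_of_ne (Finset.ne_of_mem_erase hv₁)])
      exact hne'.ne_empty (ih t' hss (fun v hv => ht v (hss.1 hv)) c' hc' hsum')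
    · rw [← Finset.add_sum_erase _ _ hv₀] at hsum
      have hm : ∀ v ∈ t.erase v₀, v ∈ Ψ ∧ 0 < c v := fun v hv =>
        ⟨ht v (Finset.mem_of_mem_erase hv), hc v (Finset.mem_of_mem_erase hv)⟩
      interval_cases hk : (t.erase v₀).card
      · rw [Finset.card_eq_zero] at hk
        rw [hk] at hsum
        exact absurd3 v₀ (ht _ hv₀) v₀ (ht _ hv₀) v₀ (ht _ hv₀) 0 0 _ le_rfl le_rfl (hc _ hv₀)
          (by simpa using hsum)
      · obtain ⟨a, ha⟩ := Finset.card_eq_one.1 hk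
        rw [ha] at hsum hm
        obtain ⟨ha1, ha2⟩ := hm a (by simp)
        exact absurd3 a ha1 a ha1 v₀ (ht _ hv₀) _ 0 _ ha2.le le_rfl (hc _ hv₀)
          (by rw [← hsum]; simp [add_comm])
      · obtain ⟨a, b, hab, ha⟩ := Finset.card_eq_two.1 hk
        rw [ha] at hsum hm
        obtain ⟨ha1, ha2⟩ := hm a (by simp)
        obtain ⟨hb1, hb2⟩ := hm b (by simp)
        exact absurd3 a ha1 b hb1 v₀ (ht _ hv₀) _ _ _ ha2.le hb2.le (hc _ hv₀)
          (by rw [← hsum, Finset.sum_pair hab]; abel)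

/-- The cone spanned by a half system is salient. -/
lemma eq_zero_of_mem_nnspan (h : IsHalf Ψ) {x : V} (hx : x ∈ nnspan Ψ) (hx' : -x ∈ nnspan Ψ) :
    x = 0 := by
  classical
  obtain ⟨c, hc, rfl⟩ := Submodule.mem_span_set.1 hx
  obtain ⟨c', hc', he⟩ := Submodule.mem_span_set.1 hx'
  have hsum : ((c + c').sum fun v r => r • v) = 0 := by
    rw [Finsupp.sum_add_index' (by simp) (by intros; rw [add_smul]), he, add_neg_cancel]
  have hempty := h.eq_empty_of_relation (c + c').support
    (fun v hv => (Finset.mem_union.1 (Finsupp.support_add hv)).elim (@hc v) (@hc' v))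
    (fun v => ((c + c') v : ℝ))
    (fun v hv => NNReal.coe_pos.2 (pos_iff_ne_zero.2 (Finsupp.mem_support_iff.1 hv))) hsum
  rw [Finsupp.support_eq_empty, add_eq_zero] at hempty
  rw [hempty.1, Finsupp.sum_zero_index]

end IsHalf

lemma nnspan_mono {X Y : Set V} (h : X ⊆ Y) : nnspan X ⊆ nnspan Y :=
  Submodule.span_mono h

lemma mem_nnspan_of_smul_mem {X : Set V} {r : ℝ} (hr : 0 < r) {v : V} (h : r • v ∈ nnspan X) :
    v ∈ nnspan X := by
  have := combo_mem_nnspan h h (inv_nonneg.2 hr.le) le_rfl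
  rwa [zero_smul, add_zero, smul_smul, inv_mul_cancel₀ hr.ne', one_smul] at this

lemma nonneg_of_mem_nnspan {X : Set V} (hX : X ⊆ Φpos) {v : V} (hv : v ∈ nnspan X) (i : Fin 3) :
    0 ≤ v i := by
  have : Submodule.span ℝ≥0 X ≤ Submodule.span ℝ≥0 Δ := Submodule.span_le.2 fun x hx => (hX hx).2
  exact mem_nnspan_Δ.1 (this hv) i

lemma form_pos_of_mem_nnspan {X : Set V} {f : V →ₗ[ℝ] ℝ} (hf : ∀ v ∈ X, 0 < f v) {v : V}
    (hv : v ∈ nnspan X) : 0 ≤ f v ∧ (f v = 0 → v = 0) := by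
  induction hv using Submodule.span_induction with
  | mem v hv => exact ⟨(hf v hv).le, fun h => ((hf v hv).ne' h).elim⟩
  | zero => simp
  | add u v _ _ hu hv =>
    rw [map_add]
    refine ⟨add_nonneg hu.1 hv.1, fun h => ?_⟩
    obtain ⟨h1, h2⟩ := (add_eq_zero_iff_of_nonneg hu.1 hv.1).1 h
    rw [hu.2 h1, hv.2 h2, add_zero]
  | smul r v _ hv =>
    have e : f (r • v) = r * f v := map_smul f (r : ℝ) v
    rw [e]
    refine ⟨mul_nonneg r.2 hv.1, fun h => ?_⟩
    rcases mul_eq_zero.1 h with h | h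
    · rw [NNReal.coe_eq_zero.1 h, zero_smul]
    · rw [hv.2 h, smul_zero]

lemma neg_mem_nnspan_twist {R : Set V} {v : V} (hv : v ∈ nnspan R) : -v ∈ nnspan (twist R) := by
  induction hv using Submodule.span_induction with
  | mem v hv => exact subset_nnspan (.inr (by simpa using hv))
  | zero => rw [neg_zero]; exact Submodule.zero_mem _
  | add u v _ _ hu hv => rw [neg_add]; exact Submodule.add_mem _ hu hv
  | smul r v _ hv => rw [← smul_neg]; exact Submodule.smul_mem _ r hv

namespace IsBiclosed

variable {R : Set V}

lemma mem_of_mem_nnspan (hR : IsBiclosed R) {v : V} (hv : v ∈ Φpos) (h : v ∈ nnspan R) :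
    v ∈ R := by
  by_contra hvR
  exact ne_zero_of_mem_Φ hv.1 (hR.isHalf_twist.eq_zero_of_mem_nnspan
    (subset_nnspan (.inl ⟨hv, hvR⟩)) (neg_mem_nnspan_twist h))

lemma exists_α_mem (hR : IsBiclosed R) (hne : R.Nonempty) : ∃ i, α i ∈ R := by
  by_contra! h
  obtain ⟨v, hv⟩ := hne
  exact (hR.2.2.Φpos_subset (fun i => ⟨α_mem_Φpos i, h i⟩) (hR.1 hv)).2 hv

end IsBiclosed

/-- The linear form `v ↦ det (a, b, v)`. -/
def detForm (a b : V) : V →ₗ[ℝ] ℝ :=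
  (a 1 * b 2 - a 2 * b 1) • LinearMap.proj 0 + (a 2 * b 0 - a 0 * b 2) • LinearMap.proj 1 +
    (a 0 * b 1 - a 1 * b 0) • LinearMap.proj 2

lemma detForm_apply (a b v : V) : detForm a b v = (a 1 * b 2 - a 2 * b 1) * v 0 +
    (a 2 * b 0 - a 0 * b 2) * v 1 + (a 0 * b 1 - a 1 * b 0) * v 2 := rfl

lemma exists_combo_of_detForm_eq_zero {a b v : V} (h : detForm a b ≠ 0) (hv : detForm a b v = 0) :
    ∃ s t : ℝ, v = s • a + t • b := by
  rw [detForm_apply] at hv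
  have of_ne : ∀ n p q : ℝ, n ≠ 0 → (∀ i, n * v i = p * a i + q * b i) →
      ∃ s t : ℝ, v = s • a + t • b := by
    refine fun n p q hn he => ⟨p / n, q / n, funext fun i => ?_⟩
    rw [← mul_right_inj' hn, he, Pi.add_apply, Pi.smul_apply, Pi.smul_apply, smul_eq_mul,
      smul_eq_mul]
    field_simp
  by_cases h2 : a 0 * b 1 - a 1 * b 0 = 0
  · by_cases h1 : a 2 * b 0 - a 0 * b 2 = 0
    · by_cases h0 : a 1 * b 2 - a 2 * b 1 = 0
      · refine (h (LinearMap.ext fun w => ?_)).elim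
        rw [detForm_apply, h0, h1, h2]
        simp
      · refine of_ne _ (v 1 * b 2 - v 2 * b 1) (a 1 * v 2 - a 2 * v 1) h0 fun i => ?_
        fin_cases i <;> simp <;> linarith
    · refine of_ne _ (v 2 * b 0 - v 0 * b 2) (a 2 * v 0 - a 0 * v 2) h1 fun i => ?_
      fin_cases i <;> simp <;> linarith
  · refine of_ne _ (v 0 * b 1 - v 1 * b 0) (a 0 * v 1 - a 1 * v 0) h2 fun i => ?_
    fin_cases i <;> simp <;> linarith

lemma exists_smul_of_detForm_eq_zero {a b : V} (ha : a ∈ Φpos) (hb : b ∈ Φpos)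
    (h : detForm a b = 0) : ∃ c : ℝ, 0 ≤ c ∧ b = c • a := by
  have h0 : a 1 * b 2 - a 2 * b 1 = 0 := by
    simpa [detForm_apply, α] using LinearMap.congr_fun h (α 0)
  have h1 : a 2 * b 0 - a 0 * b 2 = 0 := by
    simpa [detForm_apply, α] using LinearMap.congr_fun h (α 1)
  have h2 : a 0 * b 1 - a 1 * b 0 = 0 := by
    simpa [detForm_apply, α] using LinearMap.congr_fun h (α 2)
  obtain ⟨i, hi⟩ := Function.ne_iff.1 (ne_zero_of_mem_Φ ha.1)
  have hi' : a i ≠ 0 := hi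
  refine ⟨b i / a i, div_nonneg ((mem_Φpos.1 hb).2 i) ((mem_Φpos.1 ha).2 i), ?_⟩
  have key : ∀ j, a i * b j = a j * b i := by
    intro j
    fin_cases i <;> fin_cases j <;> simp <;> linarith
  ext j
  rw [Pi.smul_apply, smul_eq_mul, div_mul_eq_mul_div, eq_div_iff hi']
  linarith [key j]

lemma pos_coeff_of_mem_nnspan {X : Set V} (hX : X ⊆ Φpos) {a b : V} (ha : a ∈ Φpos)
    (haX : a ∉ nnspan X) {s t u w : ℝ} (hg : s • a + t • b ∈ nnspan X) (ht : 0 < t)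
    (hy : u • a + w • b ∈ nnspan X) (hne : u • a + w • b ≠ 0) : 0 < w := by
  by_contra! hw
  have hc := combo_mem_nnspan hy hg ht.le (neg_nonneg.2 hw)
  have e : t • (u • a + w • b) + -w • (s • a + t • b) = (t * u - w * s) • a := by module
  rw [e] at hc
  rcases lt_or_ge 0 (t * u - w * s) with hr | hr
  · exact haX (mem_nnspan_of_smul_mem hr hc)
  refine hne (funext fun i => ?_)
  have h1 := nonneg_of_mem_nnspan hX hy i
  have h2 := nonneg_of_mem_nnspan hX hg i
  have h3 := congrFun e i
  have h4 := mul_nonpos_of_nonpos_of_nonneg hr ((mem_Φpos.1 ha).2 i)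
  simp only [Pi.add_apply, Pi.smul_apply, smul_eq_mul, Pi.zero_apply] at h1 h2 h3 h4 ⊢
  have h5 := mul_nonneg (neg_nonneg.2 hw) h2
  have h6 : t * (u * a i + w * b i) ≤ 0 := by linarith
  exact le_antisymm (nonpos_of_mul_nonpos_right h6 ht) h1

lemma detForm_α_eq_zero {a b : V} {m k : Fin 3} (hmk : m ≠ k) (ha : a m = 0) (hb : b m = 0) :
    detForm a b (α k) = 0 := by
  fin_cases m <;> fin_cases k <;> simp_all [detForm_apply, α]

lemma exists_ne_ne (k l : Fin 3) : ∃ m : Fin 3, m ≠ k ∧ m ≠ l := by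
  decide +revert

lemma notMem_nnspan_iUnion {I : Type*} {R : I → Set V} (hR : ∀ i, IsBiclosed (R i)) {a b : V}
    (ha : a ∈ Φpos) (haP : a ∉ nnspan (⋃ i, R i)) (hb : b ∈ Φpos) (hbP : b ∉ nnspan (⋃ i, R i))
    {s t : ℝ} (hs : 0 ≤ s) (ht : 0 ≤ t) (hne : s • a + t • b ≠ 0) :
    s • a + t • b ∉ nnspan (⋃ i, R i) := by
  intro hg
  set X := ⋃ i, R i with hXdef
  have hRX : ∀ i, R i ⊆ X := Set.subset_iUnion R
  have hX : X ⊆ Φpos := Set.iUnion_subset fun i => (hR i).1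
  rcases hs.eq_or_lt with rfl | hs
  · rw [zero_smul, zero_add] at hg hne
    exact hbP (mem_nnspan_of_smul_mem (ht.lt_of_ne fun h => hne (by rw [← h, zero_smul])) hg)
  rcases ht.eq_or_lt with rfl | ht
  · rw [zero_smul, add_zero] at hg
    exact haP (mem_nnspan_of_smul_mem hs hg)
  have hL : detForm a b ≠ 0 := by
    intro h
    obtain ⟨c, hc, rfl⟩ := exists_smul_of_detForm_eq_zero ha hb h
    rw [smul_smul, ← add_smul] at hg
    exact haP (mem_nnspan_of_smul_mem (by positivity) hg)
  have key : ∀ y ∈ nnspan X, y ≠ 0 → detForm a b y = 0 →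
      ∃ u w : ℝ, 0 < u ∧ 0 < w ∧ y = u • a + w • b := by
    intro y hy hy0 hLy
    obtain ⟨u, w, rfl⟩ := exists_combo_of_detForm_eq_zero hL hLy
    refine ⟨u, w, ?_, pos_coeff_of_mem_nnspan hX ha haP hg ht hy hy0, rfl⟩
    rw [add_comm] at hg hy hy0
    exact pos_coeff_of_mem_nnspan hX hb hbP hg hs hy hy0
  have hRne : ∀ i, ∀ r ∈ R i, detForm a b r ≠ 0 := by
    intro i r hr h0
    obtain ⟨u, w, hu, hw, e⟩ := key r (subset_nnspan (hRX i hr))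
      (ne_zero_of_mem_Φ ((hR i).1 hr).1) h0
    have := (hR i).2.2.combo_mem ⟨ha, fun h => haP (subset_nnspan (hRX i h))⟩
      ⟨hb, fun h => hbP (subset_nnspan (hRX i h))⟩ hu.le hw.le
    rw [← e] at this
    exact (this ((hR i).1 hr)).2 hr
  have combo_zero : ∀ r r' : V, detForm a b
      (detForm a b r • r' + (-detForm a b r') • r) = 0 := by
    intro r r'
    simp only [map_add, map_smul, smul_eq_mul]
    ring
  have combo_ne : ∀ r ∈ Φpos, ∀ r' ∈ Φpos, ∀ p q : ℝ, 0 < p → 0 < q → p • r' + q • r ≠ 0 := by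
    intro r hr r' hr' p q hp hq h0
    obtain ⟨i, hi⟩ := Function.ne_iff.1 (ne_zero_of_mem_Φ hr.1)
    have h1 := congrFun h0 i
    have h2 : 0 < r i := lt_of_le_of_ne ((mem_Φpos.1 hr).2 i) (Ne.symm hi)
    have h3 := (mem_Φpos.1 hr').2 i
    simp only [Pi.add_apply, Pi.smul_apply, smul_eq_mul, Pi.zero_apply] at h1
    nlinarith [mul_pos hq h2, mul_nonneg hp.le h3]
  have hsame : ∀ i, ∀ r ∈ R i, ∀ r' ∈ R i, 0 < detForm a b r → 0 < detForm a b r' := by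
    intro i r hr r' hr' hpos
    by_contra! hle
    have hneg := neg_pos.2 (lt_of_le_of_ne hle (hRne i r' hr'))
    have hy := combo_mem_nnspan (subset_nnspan hr') (subset_nnspan hr) hpos.le hneg.le
    have hy0 := combo_ne r ((hR i).1 hr) r' ((hR i).1 hr') _ _ hpos hneg
    obtain ⟨u, w, hu, hw, e⟩ := key _ (nnspan_mono (hRX i) hy) hy0 (combo_zero r r')
    refine hy0 ((hR i).isHalf_twist.eq_zero_of_mem_nnspan ?_ (neg_mem_nnspan_twist hy))
    rw [e]
    exact combo_mem_nnspan (subset_nnspan (.inl ⟨ha, fun h => haP (subset_nnspan (hRX i h))⟩))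
      (subset_nnspan (.inl ⟨hb, fun h => hbP (subset_nnspan (hRX i h))⟩)) hu.le hw.le
  have hLg : detForm a b (s • a + t • b) = 0 := by
    simp only [map_add, map_smul, smul_eq_mul, detForm_apply]
    ring
  obtain ⟨i, r₁, hr₁, hL₁⟩ : ∃ i, ∃ r ∈ R i, 0 < detForm a b r := by
    by_contra! h
    refine hne ((form_pos_of_mem_nnspan (f := -detForm a b) (fun v hv => ?_) hg).2 ?_)
    · obtain ⟨i, hi⟩ := Set.mem_iUnion.1 hv
      exact neg_pos.2 (lt_of_le_of_ne (h i v hi) (hRne i v hi))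
    · rw [LinearMap.neg_apply, hLg, neg_zero]
  obtain ⟨j, r₂, hr₂, hL₂⟩ : ∃ i, ∃ r ∈ R i, detForm a b r < 0 := by
    by_contra! h
    refine hne ((form_pos_of_mem_nnspan (f := detForm a b) (fun v hv => ?_) hg).2 hLg)
    obtain ⟨i, hi⟩ := Set.mem_iUnion.1 hv
    exact lt_of_le_of_ne (h i v hi) (hRne i v hi).symm
  obtain ⟨k, hk⟩ := (hR i).exists_α_mem ⟨r₁, hr₁⟩
  obtain ⟨l, hl⟩ := (hR j).exists_α_mem ⟨r₂, hr₂⟩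
  have hLk := hsame i r₁ hr₁ _ hk hL₁
  have hLl : 0 < -detForm a b (α l) := neg_pos.2
    (lt_of_le_of_ne (not_lt.1 fun h => (hsame j _ hl _ hr₂ h).not_gt hL₂) (hRne j _ hl))
  obtain ⟨u, w, hu, hw, e⟩ := key _
    (combo_mem_nnspan (subset_nnspan (hRX j hl)) (subset_nnspan (hRX i hk)) hLk.le hLl.le)
    (combo_ne _ (α_mem_Φpos k) _ (α_mem_Φpos l) _ _ hLk hLl) (combo_zero _ _)
  obtain ⟨m, hmk, hml⟩ := exists_ne_ne k l
  have hm := congrFun e m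
  simp only [Pi.add_apply, Pi.smul_apply, smul_eq_mul, α, Pi.single_eq_of_ne hmk,
    Pi.single_eq_of_ne hml, mul_zero, add_zero] at hm
  have ham := (mem_Φpos.1 ha).2 m
  have hbm := (mem_Φpos.1 hb).2 m
  obtain ⟨h1, h2⟩ := (add_eq_zero_iff_of_nonneg (mul_nonneg hu.le ham)
    (mul_nonneg hw.le hbm)).1 hm.symm
  exact hLk.ne' (detForm_α_eq_zero hmk ((mul_eq_zero.1 h1).resolve_left hu.ne')
    ((mul_eq_zero.1 h2).resolve_left hw.ne'))

/-- For any collection of biclosed subsets of `Φ⁺`, the set `Φ⁺ ∩ Span_{≥0}(⋃ᵢ Rᵢ)`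
is biclosed, and it is the least upper bound of the collection in the poset of
biclosed subsets of `Φ⁺` ordered by inclusion. -/
theorem convex_closure_of_union_is_join {I : Type*} (R : I → Set V)
    (hR : ∀ i, IsBiclosed (R i)) :
    IsBiclosed (Φpos ∩ nnspan (⋃ i, R i)) ∧
    (∀ i, R i ⊆ Φpos ∩ nnspan (⋃ i, R i)) ∧
    ∀ B : Set V, IsBiclosed B → (∀ i, R i ⊆ B) → Φpos ∩ nnspan (⋃ i, R i) ⊆ B := by
  refine ⟨⟨Set.inter_subset_left, ?_, ?_⟩, ?_, ?_⟩
  · rintro a ⟨-, ha⟩ b ⟨-, hb⟩ v ⟨hv, hvp⟩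
    obtain ⟨s, t, hs, ht, rfl⟩ := mem_nnspan_pair.1 hv
    exact ⟨hvp, combo_mem_nnspan ha hb hs ht⟩
  · rintro a ⟨ha, haP⟩ b ⟨hb, hbP⟩ v ⟨hv, hvp⟩
    obtain ⟨s, t, hs, ht, rfl⟩ := mem_nnspan_pair.1 hv
    exact ⟨hvp, fun h => notMem_nnspan_iUnion hR ha (fun h => haP ⟨ha, h⟩) hb
      (fun h => hbP ⟨hb, h⟩) hs ht (ne_zero_of_mem_Φ hvp.1) h.2⟩
  · exact fun i v hv => ⟨(hR i).1 hv, subset_nnspan (Set.mem_iUnion_of_mem i hv)⟩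
  · rintro B hB hRB v ⟨hvp, hv⟩
    exact hB.mem_of_mem_nnspan hvp (nnspan_mono (Set.iUnion_subset hRB) hv)
end
end

section
/- Let R ⊆ Φ⁺ be biclosed with both R and Φ⁺ \ R infinite. Then R has at most one weakly separating hyperplane: if H and H' are 2-dimensional linear subspaces of V that are both weakly separating hyperplanes for R, then H = H'. -/
open scoped NNReal

noncomputable section

/-- `H` is a weakly separating hyperplane for `R`: a 2-dimensional linear subspace,
the kernel of a linear functional positive on `R \ H` and negative on `Φ⁺ \ (R ∪ H)`. -/
def IsWeaklySeparatingHyperplane (H : Submodule ℝ V) (R : Set V) : Prop :=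
  Module.finrank ℝ H = 2 ∧
  ∃ f : V →ₗ[ℝ] ℝ, LinearMap.ker f = H ∧
    (∀ a ∈ R, a ∉ H → 0 < f a) ∧ (∀ a ∈ Φpos, a ∉ R → a ∉ H → f a < 0)

/-! ### Real binary quadratic forms -/

/-- A quadratic polynomial whose product with `P t² + M t - N` (`P, N > 0`) is everywhere
nonnegative is proportional to it. -/
lemma proportional_of_mul_nonneg_of_opposite_signs {P M N P' M' C' : ℝ} (hP : 0 < P) (hN : 0 < N)
    (h : ∀ t : ℝ, 0 ≤ (P * t ^ 2 + M * t - N) * (P' * t ^ 2 + M' * t + C')) :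
    P * M' = P' * M ∧ P * C' = -(P' * N) := by
  set D := M ^ 2 + 4 * P * N with hD
  have hDpos : 0 < D := by positivity
  set s := √D with hs
  have hs0 : 0 < s := Real.sqrt_pos.2 hDpos
  have hss : s ^ 2 = D := Real.sq_sqrt hDpos.le
  have key : ∀ e : ℝ, P * e ^ 2 + M * e - N = 0 → 2 * P * e + M ≠ 0 →
      P' * e ^ 2 + M' * e + C' = 0 := by
    intro e he hne
    set G : ℝ → ℝ := fun d => (2 * P * e + M + P * d) * (P' * (e + d) ^ 2 + M' * (e + d) + C')
      with hG
    have hGc : Continuous G := by fun_prop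
    have hmul : ∀ d, 0 ≤ d * G d := by
      intro d
      have h1 := h (e + d)
      have h2 : P * (e + d) ^ 2 + M * (e + d) - N = d * (2 * P * e + M + P * d) := by
        linear_combination he
      rw [h2] at h1
      simpa [hG, mul_assoc] using h1
    have hG0 : G 0 = 0 := by
      have ht : Filter.Tendsto G (nhds 0) (nhds (G 0)) := hGc.tendsto 0
      apply le_antisymm
      · refine le_of_tendsto (ht.mono_left nhdsWithin_le_nhds : Filter.Tendsto G
          (nhdsWithin 0 (Set.Iio 0)) _) ?_
        filter_upwards [self_mem_nhdsWithin] with d hd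
        have hd' : d < 0 := hd
        by_contra! hc
        nlinarith [hmul d, mul_neg_of_neg_of_pos hd' hc]
      · refine ge_of_tendsto (ht.mono_left nhdsWithin_le_nhds : Filter.Tendsto G
          (nhdsWithin 0 (Set.Ioi 0)) _) ?_
        filter_upwards [self_mem_nhdsWithin] with d hd
        have hd' : 0 < d := hd
        by_contra! hc
        nlinarith [hmul d, mul_neg_of_pos_of_neg hd' hc]
    simp only [hG, mul_zero, add_zero] at hG0
    exact (mul_eq_zero.1 hG0).resolve_left hne
  have root : ∀ σ : ℝ, σ ^ 2 = D → σ ≠ 0 →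
      P' * ((σ - M) / (2 * P)) ^ 2 + M' * ((σ - M) / (2 * P)) + C' = 0 := by
    intro σ hσ hσ0
    apply key
    · field_simp
      rw [hD] at hσ
      linear_combination hσ
    · have : 2 * P * ((σ - M) / (2 * P)) + M = σ := by field_simp; ring
      rwa [this]
  have h1 := root s hss hs0.ne'
  have h2 := root (-s) (by rw [neg_sq, hss]) (neg_ne_zero.2 hs0.ne')
  field_simp at h1 h2
  have h3 : P * M' = P' * M := by
    have : s * (P * M' - P' * M) = 0 := by linear_combination (h1 - h2) / 4
    have := (mul_eq_zero.1 this).resolve_left hs0.ne'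
    linarith
  refine ⟨h3, ?_⟩
  have h4 : P * (P * C' + P' * N) = 0 := by
    linear_combination (h1 + h2) / 8 - P' / 4 * (hss.trans hD) + M / 2 * h3
  have := (mul_eq_zero.1 h4).resolve_left hP.ne'
  linarith

/-- A binary quadratic form whose coefficients in a basis `(x₁, y₁), (x₂, y₂)` vanish is zero. -/
lemma coeffs_eq_zero_of_vanishing {a b c x₁ y₁ x₂ y₂ : ℝ} (hdet : x₁ * y₂ - x₂ * y₁ ≠ 0)
    (h₁ : a * x₁ ^ 2 + b * x₁ * y₁ + c * y₁ ^ 2 = 0)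
    (h₂ : a * x₂ ^ 2 + b * x₂ * y₂ + c * y₂ ^ 2 = 0)
    (h₁₂ : 2 * a * x₁ * x₂ + b * (x₁ * y₂ + x₂ * y₁) + 2 * c * y₁ * y₂ = 0) :
    a = 0 ∧ b = 0 ∧ c = 0 := by
  have hd := pow_ne_zero 2 hdet
  refine ⟨(mul_eq_zero.1 ?_).resolve_left hd, (mul_eq_zero.1 ?_).resolve_left hd,
    (mul_eq_zero.1 ?_).resolve_left hd⟩
  · linear_combination y₂ ^ 2 * h₁ + y₁ ^ 2 * h₂ - y₁ * y₂ * h₁₂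
  · linear_combination -2 * x₂ * y₂ * h₁ - 2 * x₁ * y₁ * h₂ + (x₁ * y₂ + x₂ * y₁) * h₁₂
  · linear_combination x₂ ^ 2 * h₁ + x₁ ^ 2 * h₂ - x₁ * x₂ * h₁₂

/-- If the product of two binary quadratic forms is nonnegative and the first one is indefinite,
then the second one is a multiple of the first. -/
lemma proportional_of_indefinite {a b c a' b' c' x₁ y₁ x₂ y₂ : ℝ}
    (h : ∀ x y : ℝ, 0 ≤ (a * x ^ 2 + b * x * y + c * y ^ 2) *
      (a' * x ^ 2 + b' * x * y + c' * y ^ 2))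
    (h₁ : 0 < a * x₁ ^ 2 + b * x₁ * y₁ + c * y₁ ^ 2)
    (h₂ : a * x₂ ^ 2 + b * x₂ * y₂ + c * y₂ ^ 2 < 0) :
    ∃ k k' : ℝ, k ≠ 0 ∧ k * a' = k' * a ∧ k * b' = k' * b ∧ k * c' = k' * c := by
  set P := a * x₁ ^ 2 + b * x₁ * y₁ + c * y₁ ^ 2 with hP
  set P' := a' * x₁ ^ 2 + b' * x₁ * y₁ + c' * y₁ ^ 2 with hP'
  have hdet : x₁ * y₂ - x₂ * y₁ ≠ 0 := by
    intro h0
    have e1 : x₁ ^ 2 * (a * x₂ ^ 2 + b * x₂ * y₂ + c * y₂ ^ 2) = x₂ ^ 2 * P := by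
      rw [hP]; linear_combination (b * x₁ * x₂ + c * (x₁ * y₂ + x₂ * y₁)) * h0
    have e2 : y₁ ^ 2 * (a * x₂ ^ 2 + b * x₂ * y₂ + c * y₂ ^ 2) = y₂ ^ 2 * P := by
      rw [hP]; linear_combination (-b * y₁ * y₂ - a * (x₁ * y₂ + x₂ * y₁)) * h0
    have hx : x₁ ^ 2 = 0 := by
      nlinarith [sq_nonneg x₁, mul_nonneg (sq_nonneg x₂) h₁.le]
    have hy : y₁ ^ 2 = 0 := by
      nlinarith [sq_nonneg y₁, mul_nonneg (sq_nonneg y₂) h₁.le]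
    have hx' := pow_eq_zero_iff (two_ne_zero) |>.1 hx
    have hy' := pow_eq_zero_iff (two_ne_zero) |>.1 hy
    rw [hP, hx', hy'] at h₁
    simp at h₁
  obtain ⟨e1, e2⟩ := proportional_of_mul_nonneg_of_opposite_signs (P := P)
    (M := 2 * a * x₁ * x₂ + b * (x₁ * y₂ + x₂ * y₁) + 2 * c * y₁ * y₂)
    (N := -(a * x₂ ^ 2 + b * x₂ * y₂ + c * y₂ ^ 2)) (P' := P')
    (M' := 2 * a' * x₁ * x₂ + b' * (x₁ * y₂ + x₂ * y₁) + 2 * c' * y₁ * y₂)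
    (C' := a' * x₂ ^ 2 + b' * x₂ * y₂ + c' * y₂ ^ 2) h₁ (by linarith) (by
      intro t
      convert h (t * x₁ + x₂) (t * y₁ + y₂) using 1
      rw [hP, hP']; ring)
  obtain ⟨d1, d2, d3⟩ := coeffs_eq_zero_of_vanishing (a := P * a' - P' * a)
    (b := P * b' - P' * b) (c := P * c' - P' * c) hdet
    (by linear_combination P' * hP - P * hP') (by linear_combination e2)
    (by linear_combination e1)
  exact ⟨P, P', h₁.ne', by linarith, by linarith, by linarith⟩

/-- A nonnegative binary quadratic form with an isotropic vector is a multiple of the square of a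
linear form. -/
lemma exists_eq_mul_sq_of_nonneg {a b c x₀ y₀ : ℝ} (hne : x₀ ≠ 0 ∨ y₀ ≠ 0)
    (h : ∀ x y : ℝ, 0 ≤ a * x ^ 2 + b * x * y + c * y ^ 2)
    (h₀ : a * x₀ ^ 2 + b * x₀ * y₀ + c * y₀ ^ 2 = 0) :
    ∃ μ : ℝ, a = μ * y₀ ^ 2 ∧ b = μ * (-2 * x₀ * y₀) ∧ c = μ * x₀ ^ 2 := by
  have ha : 0 ≤ a := by simpa using h 1 0
  have hc : 0 ≤ c := by simpa using h 0 1
  have crit : ∀ m n : ℝ, 0 ≤ n → (∀ t : ℝ, 0 ≤ m * t + n * t ^ 2) → m = 0 := by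
    intro m n hn hmn
    have := hmn (-m / (n + 1))
    have e : m * (-m / (n + 1)) + n * (-m / (n + 1)) ^ 2 = -(m / (n + 1)) ^ 2 := by
      field_simp; ring
    rw [e] at this
    have h0 : (m / (n + 1)) ^ 2 = 0 := le_antisymm (by linarith) (sq_nonneg _)
    have := pow_eq_zero_iff (two_ne_zero) |>.1 h0
    exact (div_eq_zero_iff.1 this).resolve_right (by linarith)
  have g1 : 2 * a * x₀ + b * y₀ = 0 := crit _ a ha fun t => by
    have := h (x₀ + t) y₀
    linarith [this, h₀, (by ring : a * (x₀ + t) ^ 2 + b * (x₀ + t) * y₀ + c * y₀ ^ 2 =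
      (a * x₀ ^ 2 + b * x₀ * y₀ + c * y₀ ^ 2) + ((2 * a * x₀ + b * y₀) * t + a * t ^ 2))]
  have g2 : b * x₀ + 2 * c * y₀ = 0 := crit _ c hc fun t => by
    have := h x₀ (y₀ + t)
    linarith [this, h₀, (by ring : a * x₀ ^ 2 + b * x₀ * (y₀ + t) + c * (y₀ + t) ^ 2 =
      (a * x₀ ^ 2 + b * x₀ * y₀ + c * y₀ ^ 2) + ((b * x₀ + 2 * c * y₀) * t + c * t ^ 2))]
  have hn : x₀ ^ 2 + y₀ ^ 2 ≠ 0 := by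
    rcases hne with h | h <;> positivity
  refine ⟨(a + c) / (x₀ ^ 2 + y₀ ^ 2), ?_, ?_, ?_⟩ <;> field_simp
  · linear_combination x₀ / 2 * g1 - y₀ / 2 * g2
  · linear_combination y₀ * g1 + x₀ * g2
  · linear_combination -x₀ / 2 * g1 + y₀ / 2 * g2

/-- Two nonnegative binary quadratic forms, not both zero, with a common isotropic vector are
proportional. -/
lemma proportional_of_common_zero {a b c a' b' c' x₀ y₀ : ℝ} (hne : x₀ ≠ 0 ∨ y₀ ≠ 0)
    (hzero : ¬(a = 0 ∧ b = 0 ∧ c = 0))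
    (h : ∀ x y : ℝ, 0 ≤ a * x ^ 2 + b * x * y + c * y ^ 2)
    (h' : ∀ x y : ℝ, 0 ≤ a' * x ^ 2 + b' * x * y + c' * y ^ 2)
    (h₀ : a * x₀ ^ 2 + b * x₀ * y₀ + c * y₀ ^ 2 = 0)
    (h₀' : a' * x₀ ^ 2 + b' * x₀ * y₀ + c' * y₀ ^ 2 = 0) :
    ∃ k k' : ℝ, k ≠ 0 ∧ k * a' = k' * a ∧ k * b' = k' * b ∧ k * c' = k' * c := by
  obtain ⟨μ, rfl, rfl, rfl⟩ := exists_eq_mul_sq_of_nonneg hne h h₀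
  obtain ⟨μ', rfl, rfl, rfl⟩ := exists_eq_mul_sq_of_nonneg hne h' h₀'
  refine ⟨μ, μ', ?_, by ring, by ring, by ring⟩
  rintro rfl
  simp at hzero

/-! ### The roots are integral of norm one -/

lemma B_apply (x y : V) : B x y =
    2 * (x 0 * y 0 + x 1 * y 1 + x 2 * y 2) - (x 0 + x 1 + x 2) * (y 0 + y 1 + y 2) := by
  simp [B, Fin.sum_univ_three]

lemma Q_apply (x : V) : Q x =
    2 * (x 0 ^ 2 + x 1 ^ 2 + x 2 ^ 2) - (x 0 + x 1 + x 2) ^ 2 := by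
  rw [Q, B_apply]; ring

lemma B_α_apply (i : Fin 3) (x : V) : B (α i) x = 2 * x i - (x 0 + x 1 + x 2) := by
  rw [B_apply]; fin_cases i <;> simp [α]

/-- The simple reflection `r_{αᵢ}` as a linear automorphism. -/
def simpleReflection (i : Fin 3) : V ≃ₗ[ℝ] V :=
  LinearEquiv.ofInvolutive
    { toFun := fun x => x - (2 * B (α i) x) • α i
      map_add' := fun x y => by
        ext j; simp [B_α_apply]; ring
      map_smul' := fun r x => by
        ext j; simp [B_α_apply]; ring }
    (fun x => by
      change x - (2 * B (α i) x) • α i -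
        (2 * B (α i) (x - (2 * B (α i) x) • α i)) • α i = x
      simp only [B_α_apply]
      ext j
      fin_cases i <;> fin_cases j <;> simp [α] <;> ring)

lemma simpleReflection_apply (i : Fin 3) (x : V) :
    simpleReflection i x = x - (2 * B (α i) x) • α i := rfl

lemma simpleReflection_involutive (i : Fin 3) (x : V) :
    simpleReflection i (simpleReflection i x) = x :=
  (simpleReflection i).symm_apply_apply x

lemma simpleReflection_mem_W (i : Fin 3) : simpleReflection i ∈ W :=
  Subgroup.subset_closure ⟨i, fun _ => rfl⟩

lemma Q_simpleReflection (i : Fin 3) (x : V) : Q (simpleReflection i x) = Q x := by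
  rw [Q_apply, Q_apply, simpleReflection_apply, B_α_apply]
  fin_cases i <;> simp [α] <;> ring

/-- The inclusion of the root lattice `ℤ³` in `V`. -/
def intVec (z : Fin 3 → ℤ) : V := fun i => z i

lemma simpleReflection_mem_range_intVec (i : Fin 3) {x : V} (hx : x ∈ Set.range intVec) :
    simpleReflection i x ∈ Set.range intVec := by
  obtain ⟨z, rfl⟩ := hx
  refine ⟨z - Pi.single i (2 * (2 * z i - (z 0 + z 1 + z 2))), ?_⟩
  rw [simpleReflection_apply, B_α_apply]
  ext j
  by_cases h : j = i
  · subst h; simp [intVec, α]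
  · simp [intVec, α, h]

lemma W_preserves {w : V ≃ₗ[ℝ] V} (hw : w ∈ W) :
    ∀ x : V, Q (w x) = Q x ∧ (w x ∈ Set.range intVec ↔ x ∈ Set.range intVec) := by
  induction hw using Subgroup.closure_induction with
  | mem f hf =>
    obtain ⟨i, hi⟩ := hf
    intro x
    have : f x = simpleReflection i x := hi x
    rw [this]
    refine ⟨Q_simpleReflection i x, fun h => ?_, simpleReflection_mem_range_intVec i⟩
    simpa [simpleReflection_involutive] using simpleReflection_mem_range_intVec i h
  | one => intro x; simp
  | mul f g _ _ hf hg =>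
    intro x
    exact ⟨(hf (g x)).1.trans (hg x).1, (hf (g x)).2.trans (hg x).2⟩
  | inv f _ hf =>
    intro x
    have := hf (f⁻¹ x)
    have e : f (f⁻¹ x) = x := f.apply_symm_apply x
    rw [e] at this
    exact ⟨this.1.symm, this.2.symm⟩

lemma α_mem_range_intVec (i : Fin 3) : α i ∈ Set.range intVec := by
  refine ⟨Pi.single i 1, ?_⟩
  ext j
  by_cases h : j = i
  · subst h; simp [intVec, α]
  · simp [intVec, α, h]

lemma Q_α (i : Fin 3) : Q (α i) = 1 := by
  rw [Q_apply]; fin_cases i <;> simp [α] <;> norm_num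

lemma Q_eq_one_of_mem_Φ {x : V} (hx : x ∈ Φ) : Q x = 1 := by
  obtain ⟨w, hw, i, rfl⟩ := hx
  rw [(W_preserves hw _).1, Q_α]

lemma mem_range_intVec_of_mem_Φ {x : V} (hx : x ∈ Φ) : x ∈ Set.range intVec := by
  obtain ⟨w, hw, i, rfl⟩ := hx
  exact (W_preserves hw _).2.2 (α_mem_range_intVec i)

lemma simpleReflection_mem_Φ (i : Fin 3) {x : V} (hx : x ∈ Φ) : simpleReflection i x ∈ Φ := by
  obtain ⟨w, hw, j, rfl⟩ := hx
  exact ⟨simpleReflection i * w, mul_mem (simpleReflection_mem_W i) hw, j, rfl⟩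

lemma mem_nnspan_Δ_iff {x : V} : x ∈ nnspan Δ ↔ ∀ i, 0 ≤ x i := by
  constructor
  · intro hx i
    induction hx using Submodule.span_induction with
    | mem y hy =>
      obtain ⟨j, rfl⟩ := hy
      by_cases h : i = j
      · subst h; simp [α]
      · simp [α, h]
    | zero => simp
    | add y z _ _ hy hz => exact add_nonneg hy hz
    | smul r y _ hy => exact mul_nonneg r.2 hy
  · intro hx
    have e : x = ∑ i, (⟨x i, hx i⟩ : ℝ≥0) • α i := by
      ext j
      rw [Finset.sum_apply]
      simp [α, Pi.single_apply]
    rw [e]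
    exact Submodule.sum_mem _ fun i _ => Submodule.smul_mem _ _ (Submodule.subset_span ⟨i, rfl⟩)

/-! ### Every nonnegative integral vector of norm one is a positive root -/

lemma descent_step {a b c : ℤ} (ha : 0 ≤ a) (hb : 0 ≤ b) (hac : a ≤ c) (hbc : b ≤ c)
    (h : 2 * (a ^ 2 + b ^ 2 + c ^ 2) - (a + b + c) ^ 2 = 1) :
    (a = 0 ∧ b = 0 ∧ c = 1) ∨ (0 ≤ 2 * a + 2 * b - c ∧ 2 * a + 2 * b - c < c) := by
  have hprod : c * (2 * a + 2 * b - c) = (a - b) ^ 2 - 1 := by linear_combination -h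
  by_cases hab : a = b
  · left
    subst hab
    have hc : c * (c - 4 * a) = 1 := by linear_combination h
    rcases Int.eq_one_or_neg_one_of_mul_eq_one hc with h1 | h1
    · subst h1; omega
    · omega
  · right
    have hc : 0 < c := by
      rcases lt_or_gt_of_ne hab with h1 | h1 <;> omega
    have hsq : 1 ≤ (a - b) ^ 2 := by
      have : a - b ≠ 0 := sub_ne_zero.2 hab
      have := pow_pos (abs_pos.2 this) 2
      rw [sq_abs] at this
      omega
    refine ⟨?_, ?_⟩
    · by_contra! hneg
      nlinarith
    · by_contra! hge
      have hd : 0 ≤ a + b - c := by omega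
      have hsq' : (a + b - c) ^ 2 = 4 * (a * b) + 1 := by linear_combination h
      nlinarith [mul_nonneg ha hb, mul_le_mul (show a + b - c ≤ a by omega)
        (show a + b - c ≤ b by omega) hd ha]

lemma Q_intVec (z : Fin 3 → ℤ) : Q (intVec z) =
    ((2 * (z 0 ^ 2 + z 1 ^ 2 + z 2 ^ 2) - (z 0 + z 1 + z 2) ^ 2 : ℤ) : ℝ) := by
  rw [Q_apply]; simp [intVec]

lemma intVec_mem_Φ (n : ℕ) : ∀ z : Fin 3 → ℤ, (∀ i, 0 ≤ z i) → Q (intVec z) = 1 →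
    z 0 + z 1 + z 2 ≤ n → intVec z ∈ Φ := by
  induction n with
  | zero =>
    intro z hz hQ hn
    have h0 := hz 0
    have h1 := hz 1
    have h2 := hz 2
    push_cast at hn
    rw [Q_intVec, show z 0 = 0 by omega, show z 1 = 0 by omega, show z 2 = 0 by omega] at hQ
    norm_num at hQ
  | succ n ih =>
    intro z hz hQ hn
    have h0 := hz 0
    have h1 := hz 1
    have h2 := hz 2
    push_cast at hn
    have hZ : 2 * (z 0 ^ 2 + z 1 ^ 2 + z 2 ^ 2) - (z 0 + z 1 + z 2) ^ 2 = 1 := by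
      rw [Q_intVec] at hQ; exact_mod_cast hQ
    have hmax : (z 1 ≤ z 0 ∧ z 2 ≤ z 0) ∨ (z 0 ≤ z 1 ∧ z 2 ≤ z 1) ∨ (z 0 ≤ z 2 ∧ z 1 ≤ z 2) := by
      omega
    have reflect : ∀ (i : Fin 3) (z' : Fin 3 → ℤ), simpleReflection i (intVec z) = intVec z' →
        (∀ j, 0 ≤ z' j) → z' 0 + z' 1 + z' 2 ≤ n → intVec z ∈ Φ := by
      intro i z' e hz' hn'
      have hQ' : Q (intVec z') = 1 := by rw [← e, Q_simpleReflection, hQ]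
      have := simpleReflection_mem_Φ i (ih z' hz' hQ' hn')
      rwa [← e, simpleReflection_involutive] at this
    rcases hmax with ⟨u, v⟩ | ⟨u, v⟩ | ⟨u, v⟩
    · rcases descent_step h1 h2 u v (by linear_combination hZ) with ⟨e1, e2, e3⟩ | ⟨e1, e2⟩
      · convert α_mem_Φ 0
        ext j; fin_cases j <;> simp [intVec, α, e1, e2, e3]
      · refine reflect 0 ![2 * z 1 + 2 * z 2 - z 0, z 1, z 2] ?_ ?_ ?_
        · rw [simpleReflection_apply, B_α_apply]
          ext j; fin_cases j <;> simp [intVec, α]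
          ring
        · intro j; fin_cases j <;> simp [*] <;> omega
        · simp; omega
    · rcases descent_step h0 h2 u v (by linear_combination hZ) with ⟨e1, e2, e3⟩ | ⟨e1, e2⟩
      · convert α_mem_Φ 1
        ext j; fin_cases j <;> simp [intVec, α, e1, e2, e3]
      · refine reflect 1 ![z 0, 2 * z 0 + 2 * z 2 - z 1, z 2] ?_ ?_ ?_
        · rw [simpleReflection_apply, B_α_apply]
          ext j; fin_cases j <;> simp [intVec, α]
          ring
        · intro j; fin_cases j <;> simp [*] <;> omega
        · simp; omega
    · rcases descent_step h0 h1 u v (by linear_combination hZ) with ⟨e1, e2, e3⟩ | ⟨e1, e2⟩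
      · convert α_mem_Φ 2
        ext j; fin_cases j <;> simp [intVec, α, e1, e2, e3]
      · refine reflect 2 ![z 0, z 1, 2 * z 0 + 2 * z 1 - z 2] ?_ ?_ ?_
        · rw [simpleReflection_apply, B_α_apply]
          ext j; fin_cases j <;> simp [intVec, α]
          ring
        · intro j; fin_cases j <;> simp [*] <;> omega
        · simp; omega

lemma intVec_mem_Φpos {z : Fin 3 → ℤ} (hz : ∀ i, 0 ≤ z i) (hQ : Q (intVec z) = 1) :
    intVec z ∈ Φpos :=
  ⟨intVec_mem_Φ (z 0 + z 1 + z 2).toNat z hz hQ (Int.self_le_toNat _),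
    mem_nnspan_Δ_iff.2 fun i => by simpa [intVec] using hz i⟩

/-! ### Isotropic vectors and accumulation of roots -/

/-- The parametrization of the isotropic cone of `Q` by `ℝ²`. -/
def isotropic (x y : ℝ) : V := ![x ^ 2, y ^ 2, (x - y) ^ 2]

lemma isotropic_mul (t x y : ℝ) : isotropic (t * x) (t * y) = t ^ 2 • isotropic x y := by
  ext j; fin_cases j <;> simp [isotropic] <;> ring

lemma exists_eq_isotropic {x : V} (hx : ∀ i, 0 ≤ x i) (hQ : Q x = 0) :
    ∃ s t : ℝ, x = isotropic s t := by
  obtain ⟨s, hs, e0⟩ : ∃ s : ℝ, 0 ≤ s ∧ s ^ 2 = x 0 := ⟨_, Real.sqrt_nonneg _, Real.sq_sqrt (hx 0)⟩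
  obtain ⟨t, ht, e1⟩ : ∃ s : ℝ, 0 ≤ s ∧ s ^ 2 = x 1 := ⟨_, Real.sqrt_nonneg _, Real.sq_sqrt (hx 1)⟩
  rw [Q_apply, ← e0, ← e1] at hQ
  have : (x 2 - (s - t) ^ 2) * (x 2 - (s - -t) ^ 2) = 0 := by linear_combination hQ
  rcases mul_eq_zero.1 this with h | h
  · refine ⟨s, t, ?_⟩
    ext j; fin_cases j
    · simp [isotropic, e0]
    · simp [isotropic, e1]
    · simp [isotropic]; linarith
  · refine ⟨s, -t, ?_⟩
    ext j; fin_cases j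
    · simp [isotropic, e0]
    · simp [isotropic, e1]
    · simp [isotropic]; linarith

/-- The roots accumulate only at the isotropic cone. -/
lemma finite_Φpos_nonpos (g : V →ₗ[ℝ] ℝ)
    (hg : ∀ x y : ℝ, (x ≠ 0 ∨ y ≠ 0) → 0 < g (isotropic x y)) :
    {a ∈ Φpos | g a ≤ 0}.Finite := by
  have hgc : Continuous g := g.continuous_of_finiteDimensional
  set K : Set V := {x ∈ stdSimplex ℝ (Fin 3) | g x ≤ 0} with hK
  have hKc : IsCompact K :=
    (isCompact_stdSimplex ℝ (Fin 3)).inter_right (isClosed_le hgc continuous_const)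
  have hQc : Continuous Q := by
    have : Q = fun x : V => 2 * (x 0 ^ 2 + x 1 ^ 2 + x 2 ^ 2) - (x 0 + x 1 + x 2) ^ 2 :=
      funext Q_apply
    rw [this]; fun_prop
  have hQK : ∀ x ∈ K, 0 < |Q x| := by
    rintro x ⟨⟨hx0, hx1⟩, hgx⟩
    refine abs_pos.2 fun h0 => ?_
    obtain ⟨s, t, rfl⟩ := exists_eq_isotropic hx0 h0
    refine absurd hgx (not_le.2 (hg s t ?_))
    by_contra! hst
    simp [Fin.sum_univ_three, isotropic, hst.1, hst.2] at hx1
  obtain ⟨δ, hδ, hδK⟩ : ∃ δ > 0, ∀ x ∈ K, δ ≤ |Q x| := by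
    rcases K.eq_empty_or_nonempty with he | hne
    · exact ⟨1, one_pos, by simp [he]⟩
    · obtain ⟨x, hx, hmin⟩ := hKc.exists_isMinOn hne (hQc.abs).continuousOn
      exact ⟨|Q x|, hQK x hx, fun y hy => hmin hy⟩
  obtain ⟨N, hN⟩ := exists_nat_gt (1 / δ + 1)
  refine ((Set.finite_Icc (0 : Fin 3 → ℤ) (fun _ => (N : ℤ))).image intVec).subset ?_
  rintro a ⟨⟨haΦ, hapos⟩, hga⟩
  rw [mem_nnspan_Δ_iff] at hapos
  have hQa := Q_eq_one_of_mem_Φ haΦ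
  obtain ⟨z, rfl⟩ := mem_range_intVec_of_mem_Φ haΦ
  set a := intVec z with ha
  set S := a 0 + a 1 + a 2 with hS
  have p0 := hapos 0
  have p1 := hapos 1
  have p2 := hapos 2
  have hS0 : 0 < S := by
    rcases (show 0 ≤ S by positivity).lt_or_eq with h | h
    · exact h
    · rw [Q_apply, show a 0 = 0 by linarith, show a 1 = 0 by linarith,
        show a 2 = 0 by linarith] at hQa
      norm_num at hQa
  have hmem : S⁻¹ • a ∈ K := by
    refine ⟨⟨fun i => mul_nonneg (inv_nonneg.2 hS0.le) (hapos i), ?_⟩, ?_⟩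
    · simp only [Fin.sum_univ_three, Pi.smul_apply, smul_eq_mul]
      rw [← mul_add, ← mul_add, ← hS, inv_mul_cancel₀ hS0.ne']
    · rw [map_smul, smul_eq_mul]
      exact mul_nonpos_of_nonneg_of_nonpos (inv_nonneg.2 hS0.le) hga
  have hQS : Q (S⁻¹ • a) = (S⁻¹) ^ 2 := by
    rw [← mul_one (S⁻¹ ^ 2), ← hQa, Q_apply, Q_apply]
    simp only [Pi.smul_apply, smul_eq_mul]; ring
  have hle := hδK _ hmem
  rw [hQS, abs_of_nonneg (sq_nonneg _)] at hle
  have hS2 : S ^ 2 ≤ 1 / δ := by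
    rw [inv_pow] at hle
    rw [le_div_iff₀ hδ]
    have := mul_le_mul_of_nonneg_left hle (sq_nonneg S)
    rwa [mul_inv_cancel₀ (pow_ne_zero 2 hS0.ne')] at this
  have hSN : S < N := by nlinarith [sq_nonneg (S - 1)]
  refine ⟨z, ⟨fun i => ?_, fun i => ?_⟩, rfl⟩
  · have := hapos i
    simpa [ha, intVec] using this
  · have : a i ≤ N := by fin_cases i <;> simp <;> linarith
    have h' : (z i : ℝ) ≤ N := this
    exact_mod_cast h'

lemma nonneg_of_eventually_quadratic_nonneg {d m n : ℝ} {K : ℕ}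
    (h : ∀ k : ℕ, K ≤ k → 0 ≤ d * (k : ℝ) ^ 2 + m * k + n) : 0 ≤ d := by
  by_contra! hd
  obtain ⟨k, hk⟩ := exists_nat_gt ((|m| + |n|) / -d)
  rw [div_lt_iff₀ (by linarith)] at hk
  set l := max (max k K) 1 with hl
  have hkl : (k : ℝ) ≤ l := by exact_mod_cast (le_max_left k K).trans (le_max_left _ _)
  have h1l : (1 : ℝ) ≤ l := by exact_mod_cast le_max_right _ _
  have := h l ((le_max_right k K).trans (le_max_left _ _))
  have hl' : |m| + |n| < l * -d := hk.trans_le (mul_le_mul_of_nonneg_right hkl (by linarith))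
  have h2 := mul_lt_mul_of_pos_right hl' (show (0 : ℝ) < l by linarith)
  nlinarith [le_abs_self m, le_abs_self n, mul_le_mul_of_nonneg_right (le_abs_self m)
    (show (0 : ℝ) ≤ l by linarith), mul_le_mul_of_nonneg_left h1l (abs_nonneg n)]

lemma mul_nonneg_isotropic_of_coprime {f f' : V →ₗ[ℝ] ℝ} (h : ∀ a ∈ Φpos, 0 ≤ f a * f' a)
    {p q : ℤ} (hpq : IsCoprime p q) : 0 ≤ f (isotropic p q) * f' (isotropic p q) := by
  obtain ⟨s, r, hsr⟩ := hpq
  set e : Fin 3 → ℤ := ![p * -r, q * s, (p - q) * (-r - s)] with he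
  obtain ⟨K, hK⟩ : ∃ K : ℕ, ∀ i, -e i ≤ K :=
    ⟨(e 0).natAbs + (e 1).natAbs + (e 2).natAbs, fun i => by
      push_cast
      fin_cases i <;> dsimp only [Fin.reduceFinMk, Fin.zero_eta, Fin.mk_one] <;>
        linarith [neg_le_abs (e 0), neg_le_abs (e 1), neg_le_abs (e 2),
          abs_nonneg (e 0), abs_nonneg (e 1), abs_nonneg (e 2)]⟩
  refine nonneg_of_eventually_quadratic_nonneg (K := K)
    (m := f (isotropic p q) * f' (intVec e) + f' (isotropic p q) * f (intVec e))
    (n := f (intVec e) * f' (intVec e)) fun k hk => ?_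
  set z : Fin 3 → ℤ := ![p * (-r + k * p), q * (s + k * q), (p - q) * (-r + k * p - (s + k * q))]
    with hz
  have hz_eq : intVec z = (k : ℝ) • isotropic p q + intVec e := by
    ext j; fin_cases j <;> simp [intVec, hz, he, isotropic] <;> ring
  have nonneg : ∀ u v : ℤ, -(u * v) ≤ K → 0 ≤ u * (v + k * u) := by
    intro u v huv
    rcases eq_or_ne u 0 with rfl | hu
    · simp
    · have hu2 : 1 ≤ u ^ 2 := by
        have := pow_pos (abs_pos.2 hu) 2
        rw [sq_abs] at this
        omega
      have hk' : (K : ℤ) ≤ k := by exact_mod_cast hk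
      nlinarith [mul_le_mul_of_nonneg_left hu2 (Int.natCast_nonneg k)]
  have hzpos : ∀ i, 0 ≤ z i := by
    intro i
    fin_cases i
    · exact nonneg p (-r) (by simpa [he] using hK 0)
    · exact nonneg q s (by simpa [he] using hK 1)
    · have := nonneg (p - q) (-r - s) (hK 2)
      have e2 : z 2 = (p - q) * (-r - s + k * (p - q)) := by simp [hz]; left; ring
      change 0 ≤ z 2
      rwa [e2]
  have hQ : Q (intVec z) = 1 := by
    rw [Q_intVec]
    have : 2 * (z 0 ^ 2 + z 1 ^ 2 + z 2 ^ 2) - (z 0 + z 1 + z 2) ^ 2 = (s * p + r * q) ^ 2 := by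
      simp [hz]; ring
    rw [this, hsr]; norm_num
  have := h _ (intVec_mem_Φpos hzpos hQ)
  rw [hz_eq] at this
  simp only [map_add, map_smul, smul_eq_mul] at this
  linarith

/-- Every isotropic vector is a limit of multiples of roots. -/
lemma mul_nonneg_isotropic {f f' : V →ₗ[ℝ] ℝ} (h : ∀ a ∈ Φpos, 0 ≤ f a * f' a) (x y : ℝ) :
    0 ≤ f (isotropic x y) * f' (isotropic x y) := by
  have scale : ∀ t x y : ℝ, f (isotropic (t * x) (t * y)) * f' (isotropic (t * x) (t * y)) =
      (t ^ 2) ^ 2 * (f (isotropic x y) * f' (isotropic x y)) := by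
    intro t x y
    simp only [isotropic_mul, map_smul, smul_eq_mul]; ring
  have hrat : ∀ r : ℚ, 0 ≤ f (isotropic r 1) * f' (isotropic r 1) := by
    intro r
    have hcop : IsCoprime r.num (r.den : ℤ) := by
      rw [Int.isCoprime_iff_gcd_eq_one]
      simpa [Int.gcd] using r.reduced
    have h1 := mul_nonneg_isotropic_of_coprime h hcop
    have hd : (0 : ℝ) < r.den := by exact_mod_cast r.den_pos
    have e : ((r.num : ℤ) : ℝ) = r.den * (r : ℝ) := by
      rw [Rat.cast_def]; field_simp
    have e' : (((r.den : ℤ) : ℤ) : ℝ) = r.den * 1 := by simp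
    rw [e, e', scale] at h1
    exact nonneg_of_mul_nonneg_right h1 (by positivity)
  have hreal : ∀ t : ℝ, 0 ≤ f (isotropic t 1) * f' (isotropic t 1) := by
    have hiso : Continuous fun t : ℝ => isotropic t 1 := by
      refine continuous_pi fun j => ?_
      fin_cases j <;> simp [isotropic] <;> fun_prop
    have hc : IsClosed {t : ℝ | 0 ≤ f (isotropic t 1) * f' (isotropic t 1)} :=
      isClosed_le continuous_const
        ((f.continuous_of_finiteDimensional.comp hiso).mul
          (f'.continuous_of_finiteDimensional.comp hiso))
    exact fun t => Rat.denseRange_cast.induction_on t hc hrat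
  rcases eq_or_ne y 0 with rfl | hy
  · have h1 := mul_nonneg_isotropic_of_coprime h (isCoprime_one_left : IsCoprime (1 : ℤ) 0)
    have e := scale x 1 0
    rw [mul_one, mul_zero] at e
    rw [e]
    exact mul_nonneg (by positivity) (by simpa using h1)
  · have e := scale y (x / y) 1
    rw [mul_one, mul_div_cancel₀ x hy] at e
    rw [e]
    exact mul_nonneg (by positivity) (hreal _)

/-! ### Uniqueness of the weakly separating hyperplane -/

lemma apply_isotropic (f : V →ₗ[ℝ] ℝ) (x y : ℝ) : f (isotropic x y) =
    (f (α 0) + f (α 2)) * x ^ 2 + (-2 * f (α 2)) * x * y + (f (α 1) + f (α 2)) * y ^ 2 := by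
  have : isotropic x y = x ^ 2 • α 0 + y ^ 2 • α 1 + (x - y) ^ 2 • α 2 := by
    ext j; fin_cases j <;> simp [isotropic, α]
  rw [this]
  simp only [map_add, map_smul, smul_eq_mul]; ring

lemma functional_ext {f g : V →ₗ[ℝ] ℝ} (h : ∀ i, f (α i) = g (α i)) : f = g :=
  (Pi.basisFun ℝ (Fin 3)).ext fun i => by simpa [α] using h i

lemma eq_zero_of_coeffs {f : V →ₗ[ℝ] ℝ} (h : f (α 0) + f (α 2) = 0 ∧ -2 * f (α 2) = 0 ∧
    f (α 1) + f (α 2) = 0) : f = 0 :=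
  functional_ext fun i => by
    obtain ⟨h0, h1, h2⟩ := h
    fin_cases i <;> simp <;> linarith

lemma ker_eq_of_proportional {f f' : V →ₗ[ℝ] ℝ} (hf' : f' ≠ 0) {k k' : ℝ} (hk : k ≠ 0)
    (h : k * (f' (α 0) + f' (α 2)) = k' * (f (α 0) + f (α 2)) ∧
      k * (-2 * f' (α 2)) = k' * (-2 * f (α 2)) ∧
      k * (f' (α 1) + f' (α 2)) = k' * (f (α 1) + f (α 2))) :
    LinearMap.ker f = LinearMap.ker f' := by
  obtain ⟨h0, h1, h2⟩ := h
  have e : k • f' = k' • f := functional_ext fun i => by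
    fin_cases i <;> simp <;> linarith
  have hk' : k' ≠ 0 := by
    rintro rfl
    rw [zero_smul] at e
    exact (smul_ne_zero hk hf') e
  rw [← LinearMap.ker_smul f k' hk', ← e, LinearMap.ker_smul f' k hk]

/-- If two functionals are nonnegative on the isotropic cone and both nonpositive on infinitely
many positive roots, then they have the same kernel. -/
lemma ker_eq_of_nonneg {f f' : V →ₗ[ℝ] ℝ} (hf : f ≠ 0) (hf' : f' ≠ 0)
    (h : ∀ x y, 0 ≤ f (isotropic x y)) (h' : ∀ x y, 0 ≤ f' (isotropic x y))
    {T : Set V} (hT : T ⊆ Φpos) (hinf : T.Infinite) (hTf : ∀ a ∈ T, f a ≤ 0)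
    (hTf' : ∀ a ∈ T, f' a ≤ 0) : LinearMap.ker f = LinearMap.ker f' := by
  by_contra hne
  refine hinf ((finite_Φpos_nonpos (f + f') fun x y hxy => ?_).subset fun a ha =>
    ⟨hT ha, add_nonpos (hTf a ha) (hTf' a ha)⟩)
  by_contra! hle
  rw [LinearMap.add_apply] at hle
  have z : f (isotropic x y) = 0 := le_antisymm (by linarith [h' x y]) (h x y)
  have z' : f' (isotropic x y) = 0 := le_antisymm (by linarith [h x y]) (h' x y)
  simp only [apply_isotropic] at h h' z z'
  obtain ⟨k, k', hk, e⟩ := proportional_of_common_zero hxy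
    (fun h0 => hf (eq_zero_of_coeffs h0)) h h' z z'
  exact hne (ker_eq_of_proportional hf' hk e)

lemma ker_eq_of_indefinite {f f' : V →ₗ[ℝ] ℝ} (hf' : f' ≠ 0)
    (h : ∀ x y, 0 ≤ f (isotropic x y) * f' (isotropic x y))
    (hpos : ∃ x y, 0 < f (isotropic x y)) (hneg : ∃ x y, f (isotropic x y) < 0) :
    LinearMap.ker f = LinearMap.ker f' := by
  obtain ⟨x₁, y₁, h₁⟩ := hpos
  obtain ⟨x₂, y₂, h₂⟩ := hneg
  simp only [apply_isotropic] at h h₁ h₂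
  obtain ⟨k, k', hk, hcoeffs⟩ := proportional_of_indefinite h h₁ h₂
  exact ker_eq_of_proportional hf' hk hcoeffs

/-- If `f f' ≥ 0` on the isotropic cone and `f` is positive somewhere on it, then so is `f'`. -/
lemma exists_pos_of_mul_nonneg {f f' : V →ₗ[ℝ] ℝ} (hf' : f' ≠ 0)
    (h : ∀ x y, 0 ≤ f (isotropic x y) * f' (isotropic x y))
    (hpos : ∃ x y, 0 < f (isotropic x y)) : ∃ x y, 0 < f' (isotropic x y) := by
  obtain ⟨x, y, hxy⟩ := hpos
  by_contra! hle
  have hne : x ≠ 0 ∨ y ≠ 0 := by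
    by_contra! h0
    simp [apply_isotropic, h0.1, h0.2] at hxy
  have h0 : f' (isotropic x y) = 0 := le_antisymm (hle x y) (nonneg_of_mul_nonneg_right (h x y) hxy)
  have hn : ∀ x y, 0 ≤ (-f') (isotropic x y) := fun x y => neg_nonneg.2 (hle x y)
  have h0n : (-f') (isotropic x y) = 0 := neg_eq_zero.2 h0
  simp only [apply_isotropic (-f')] at hn h0n
  obtain ⟨μ, e0, e1, e2⟩ := exists_eq_mul_sq_of_nonneg hne hn h0n
  have hμ : μ ≠ 0 := by
    rintro rfl
    simp only [zero_mul] at e0 e1 e2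
    exact neg_ne_zero.2 hf' (eq_zero_of_coeffs ⟨e0, e1, e2⟩)
  have hform : ∀ t : ℝ, f' (isotropic (x - t * y) (y + t * x)) =
      -μ * (t * (x ^ 2 + y ^ 2)) ^ 2 := fun t => by
    have := apply_isotropic (-f') (x - t * y) (y + t * x)
    rw [e0, e1, e2, LinearMap.neg_apply] at this
    linear_combination -this
  have hxy2 : x ^ 2 + y ^ 2 ≠ 0 := by
    rcases hne with h | h <;> positivity
  have hc : Continuous fun t : ℝ => f (isotropic (x - t * y) (y + t * x)) := by
    simp only [apply_isotropic]; fun_prop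
  refine absurd hxy (not_lt.2 ?_)
  have ht : Filter.Tendsto (fun t : ℝ => f (isotropic (x - t * y) (y + t * x)))
      (nhdsWithin 0 {0}ᶜ) (nhds (f (isotropic x y))) := by
    simpa using (hc.tendsto 0).mono_left nhdsWithin_le_nhds
  refine le_of_tendsto ht ?_
  filter_upwards [self_mem_nhdsWithin] with t ht0
  have hlt : f' (isotropic (x - t * y) (y + t * x)) < 0 := by
    refine lt_of_le_of_ne (hle _ _) ?_
    rw [hform]
    exact mul_ne_zero (neg_ne_zero.2 hμ) (pow_ne_zero 2 (mul_ne_zero ht0 hxy2))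
  by_contra! hp
  exact absurd (h _ _) (not_le.2 (mul_neg_of_pos_of_neg hp hlt))

lemma ne_zero_of_finrank_ker {f : V →ₗ[ℝ] ℝ} (h : Module.finrank ℝ (LinearMap.ker f) = 2) :
    f ≠ 0 := by
  rintro rfl
  rw [LinearMap.ker_zero, finrank_top] at h
  simp at h

/-- A biclosed set `R ⊆ Φ⁺` with both `R` and `Φ⁺ \ R` infinite has at most one
weakly separating hyperplane. -/
theorem weakly_separating_hyperplane_unique (R : Set V) (hR : IsBiclosed R)
    (hinf : R.Infinite) (hcoinf : (Φpos \ R).Infinite)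
    (H H' : Submodule ℝ V)
    (hH : IsWeaklySeparatingHyperplane H R) (hH' : IsWeaklySeparatingHyperplane H' R) :
    H = H' := by
  obtain ⟨hr, f, rfl, hp, hn⟩ := hH
  obtain ⟨hr', f', rfl, hp', hn'⟩ := hH'
  have hf := ne_zero_of_finrank_ker hr
  have hf' := ne_zero_of_finrank_ker hr'
  have nonneg_on : ∀ g : V →ₗ[ℝ] ℝ, (∀ a ∈ R, a ∉ LinearMap.ker g → 0 < g a) →
      ∀ a ∈ R, 0 ≤ g a := fun g hg a ha => by
    by_cases h : a ∈ LinearMap.ker g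
    · exact (LinearMap.mem_ker.1 h).ge
    · exact (hg a ha h).le
  have nonpos_on : ∀ g : V →ₗ[ℝ] ℝ, (∀ a ∈ Φpos, a ∉ R → a ∉ LinearMap.ker g → g a < 0) →
      ∀ a ∈ Φpos \ R, g a ≤ 0 := fun g hg a ha => by
    by_cases h : a ∈ LinearMap.ker g
    · exact (LinearMap.mem_ker.1 h).le
    · exact (hg a ha.1 ha.2 h).le
  replace hp := nonneg_on f hp
  replace hp' := nonneg_on f' hp'
  replace hn := nonpos_on f hn
  replace hn' := nonpos_on f' hn'
  have hmul : ∀ x y, 0 ≤ f (isotropic x y) * f' (isotropic x y) :=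
    mul_nonneg_isotropic fun a ha => by
      by_cases haR : a ∈ R
      · exact mul_nonneg (hp a haR) (hp' a haR)
      · exact mul_nonneg_of_nonpos_of_nonpos (hn a ⟨ha, haR⟩) (hn' a ⟨ha, haR⟩)
  have hmul' : ∀ x y, 0 ≤ f' (isotropic x y) * f (isotropic x y) := fun x y => by
    rw [mul_comm]; exact hmul x y
  by_cases hpos : ∃ x y, 0 < f (isotropic x y)
  · by_cases hneg : ∃ x y, f (isotropic x y) < 0
    · exact ker_eq_of_indefinite hf' hmul hpos hneg
    · push Not at hneg
      by_cases hneg' : ∃ x y, f' (isotropic x y) < 0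
      · exact (ker_eq_of_indefinite hf hmul'
          (exists_pos_of_mul_nonneg hf' hmul hpos) hneg').symm
      · push Not at hneg'
        exact ker_eq_of_nonneg hf hf' hneg hneg' Set.sdiff_subset hcoinf hn hn'
  · push Not at hpos
    by_cases hpos' : ∃ x y, 0 < f' (isotropic x y)
    · exact absurd (exists_pos_of_mul_nonneg hf hmul' hpos') (by push Not; exact hpos)
    · push Not at hpos'
      have := ker_eq_of_nonneg (f := -f) (f' := -f') (neg_ne_zero.2 hf) (neg_ne_zero.2 hf')
        (fun x y => neg_nonneg.2 (hpos x y)) (fun x y => neg_nonneg.2 (hpos' x y)) hR.1 hinf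
        (fun a ha => neg_nonpos.2 (hp a ha)) (fun a ha => neg_nonpos.2 (hp' a ha))
      simpa [LinearMap.ext_iff, Submodule.ext_iff] using this
end
end
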